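/- Let (R,𝔪) be an equidimensional Noetherian local ring. Then R is generalized Cohen–Macaulay if and only if for every prime ideal 𝔭 ≠ 𝔪, the localization R_𝔭 is a Cohen–Macaulay ring and R/𝔭 has a uniform local cohomological annihilator. -/

import Mathlib

noncomputable section
open CategoryTheory

namespace Paper

variable (R : Type) [CommRing R]

/-- The `i`-th local cohomology of the `R`-module `M` with respect to the ideal `I`. -/
abbrev H (I : Ideal R) (i : ℕ) (M : Type) [AddCommGroup M] [Module R M] : ModuleCat R :=
  (localCohomology I i).obj (ModuleCat.of R M)

/-- `N` is a `p`-secondary submodule of `M`: it is nonzero, every `r : R` acts on it either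
surjectively or nilpotently, and `p` is the radical of its annihilator. -/
def IsSecondaryFor {M : Type} [AddCommGroup M] [Module R M]
    (N : Submodule R M) (p : Ideal R) : Prop :=
  N ≠ ⊥ ∧
  (∀ r : R, (∀ m ∈ N, ∃ n ∈ N, r • n = m) ∨ (∃ k : ℕ, ∀ m ∈ N, r ^ k • m = 0)) ∧
  N.annihilator.radical = p

/-- A minimal secondary representation of the module `M`. -/
structure MinSecRep (M : Type) [AddCommGroup M] [Module R M] where
  n : ℕ
  S : Fin n → Submodule R M
  p : Fin n → Ideal R
  prime : ∀ i, (p i).IsPrime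
  sec : ∀ i, IsSecondaryFor R (S i) (p i)
  sum : (⨆ i, S i) = ⊤
  inj : Function.Injective p
  irred : ∀ j, ¬ (S j ≤ ⨆ i ∈ ({j}ᶜ : Set (Fin n)), S i)

/-- `M` is representable: it is a (finite) sum of secondary submodules. -/
def IsRepresentable (M : Type) [AddCommGroup M] [Module R M] : Prop :=
  ∃ (n : ℕ) (S : Fin n → Submodule R M) (p : Fin n → Ideal R),
    (∀ i, (p i).IsPrime) ∧ (∀ i, IsSecondaryFor R (S i) (p i)) ∧ (⨆ i, S i) = ⊤

/-- The set of attached primes of `M`: the primes occurring in a minimal secondary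
representation of `M`. -/
def attached (M : Type) [AddCommGroup M] [Module R M] : Set (Ideal R) :=
  {q | ∃ (rep : MinSecRep R M) (i : Fin rep.n), rep.p i = q}

/-- The coheight (dimension of `R/I`): Krull dimension of the set of primes containing `I`. -/
def coheight (I : Ideal R) : WithBot ℕ∞ :=
  Order.krullDim {p : Ideal R // p.IsPrime ∧ I ≤ p}

/-- The Krull dimension of the ring `R`. -/
def ringDim : WithBot ℕ∞ := Order.krullDim {p : Ideal R // p.IsPrime}

/-- The Krull dimension of (the support of) the finitely generated module `M`. -/
def dimMod (M : Type) [AddCommGroup M] [Module R M] : WithBot ℕ∞ :=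
  coheight R (Module.annihilator R M)

/-- The dimension of the localized module `M_q`: chains of primes in the support of `M`
contained in `q`. -/
def dimModAt (M : Type) [AddCommGroup M] [Module R M] (q : Ideal R) : WithBot ℕ∞ :=
  Order.krullDim {p : Ideal R // p.IsPrime ∧ Module.annihilator R M ≤ p ∧ p ≤ q}

/-- The support of a finitely generated module: primes containing the annihilator. -/
def supp (M : Type) [AddCommGroup M] [Module R M] : Set (Ideal R) :=
  {p | p.IsPrime ∧ Module.annihilator R M ≤ p}

/-- `Min M`: minimal primes of the support of `M`. -/
def minSupp (M : Type) [AddCommGroup M] [Module R M] : Set (Ideal R) :=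
  (Module.annihilator R M).minimalPrimes

/-- `Assh M`: primes in the support of maximal coheight. -/
def assh (M : Type) [AddCommGroup M] [Module R M] : Set (Ideal R) :=
  {p | p ∈ supp R M ∧ coheight R p = dimMod R M}

open RingTheory.Sequence in
/-- Depth of `M` with respect to the ideal `J`: supremum of the lengths of `M`-regular
sequences contained in `J`. -/
def depthOn (J : Ideal R) (M : Type) [AddCommGroup M] [Module R M] : ℕ∞ :=
  ⨆ l ∈ {l : List R | (∀ x ∈ l, x ∈ J) ∧ IsRegular M l}, (l.length : ℕ∞)

/-- `M` is a Cohen–Macaulay module over the local ring `R`: depth = dimension. -/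
def IsCMLocalMod [IsLocalRing R] (M : Type) [AddCommGroup M] [Module R M] : Prop :=
  (depthOn R (IsLocalRing.maximalIdeal R) M : WithBot ℕ∞) = dimMod R M

/-- `R` is a Cohen–Macaulay local ring: it is local and its depth (w.r.t. its Jacobson
radical, which is the maximal ideal) equals its Krull dimension. -/
def IsCMLocalRing : Prop :=
  IsLocalRing R ∧ ((depthOn R ((⊥ : Ideal R).jacobson) R : WithBot ℕ∞) = ringDim R)

/-- `R` is a Cohen–Macaulay ring: all of its localizations at primes are CM local rings. -/
def IsCMRing : Prop :=
  ∀ (p : Ideal R) [p.IsPrime], IsCMLocalRing (Localization.AtPrime p)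

/-- `M` is an equidimensional module: every minimal prime of its support has coheight equal
to the dimension of `M`. -/
def IsEquidim (M : Type) [AddCommGroup M] [Module R M] : Prop :=
  ∀ q ∈ minSupp R M, coheight R q = dimMod R M

/-- `R` is catenary: any two saturated chains of primes with the same endpoints have the
same length. -/
def IsCatenary : Prop :=
  ∀ (c₁ c₂ : LTSeries {p : Ideal R // p.IsPrime}),
    c₁.head = c₂.head → c₁.last = c₂.last →
    (∀ i : Fin c₁.length, c₁.toFun i.castSucc ⋖ c₁.toFun i.succ) →
    (∀ i : Fin c₂.length, c₂.toFun i.castSucc ⋖ c₂.toFun i.succ) →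
    c₁.length = c₂.length

/-- `R` is universally catenary: every finitely generated `R`-algebra is catenary. -/
def IsUnivCatenary : Prop :=
  ∀ (A : Type) [CommRing A] [Algebra R A], Algebra.FiniteType R A → IsCatenary A

/-- `x` is a uniform local cohomological annihilator of `M`: `x` avoids all minimal primes
of `M` and, for every maximal ideal `m`, kills `H^i_m(M)` for all `i < dim M_m`. -/
def IsULCA (M : Type) [AddCommGroup M] [Module R M] (x : R) : Prop :=
  (∀ p ∈ minSupp R M, x ∉ p) ∧
  ∀ (m : Ideal R), m.IsMaximal → ∀ i : ℕ, (i : WithBot ℕ∞) < dimModAt R M m →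
    ∀ y : H R m i M, x • y = 0

/-- `M` has a uniform local cohomological annihilator. -/
def HasULCA (M : Type) [AddCommGroup M] [Module R M] : Prop := ∃ x, IsULCA R M x

/-- `R/p` has a uniform local cohomological annihilator (local case): some `x ∉ p` kills
`H^i_𝔪(R/p)` for all `i < dim R/p`. -/
def HasULCAQuot [IsLocalRing R] (p : Ideal R) : Prop :=
  ∃ x ∉ p, ∀ i : ℕ, (i : WithBot ℕ∞) < coheight R p →
    ∀ y : H R (IsLocalRing.maximalIdeal R) i (R ⧸ p), x • y = 0

/-- `M` is generalized Cohen–Macaulay over the local ring `R`: a power of the maximal ideal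
kills all local cohomology below the dimension. -/
def IsGCM [IsLocalRing R] (M : Type) [AddCommGroup M] [Module R M] : Prop :=
  ∃ n : ℕ, ∀ i : ℕ, (i : WithBot ℕ∞) < dimMod R M →
    ∀ a ∈ (IsLocalRing.maximalIdeal R) ^ n,
      ∀ y : H R (IsLocalRing.maximalIdeal R) i M, a • y = 0

end Paper

open Limits Opposite in
/-- The projection `R ⧸ I ^ b ⟶ R ⧸ I ^ a` for `a ≤ b`. -/
def powProj {R : Type} [CommRing R] (I : Ideal R) {a b : ℕ} (h : a ≤ b) :
    ModuleCat.of R (R ⧸ I ^ b) ⟶ ModuleCat.of R (R ⧸ I ^ a) :=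
  ModuleCat.ofHom (Submodule.mapQ _ _ LinearMap.id (Ideal.pow_le_pow_right h))

lemma ModuleCat.hom_apply_smul {R : Type} [CommRing R] {A B : ModuleCat.{0} R} (f : A ⟶ B)
    (c : R) (x : A) : f (c • x) = c • f x :=
  f.hom.map_smul c x

open Limits Opposite in
lemma smul_localCohomology_eq_zero_iff {R : Type} [CommRing R] (I : Ideal R) (c : R) (i : ℕ)
    (M : ModuleCat.{0} R) :
    (∀ y : (localCohomology I i).obj M, c • y = 0) ↔
      ∀ (a : ℕ) (e : ((Ext R (ModuleCat.{0} R) i).obj (op (ModuleCat.of R (R ⧸ I ^ a)))).obj M),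
        ∃ (b : ℕ) (h : a ≤ b),
          ((Ext R (ModuleCat.{0} R) i).map (powProj I h).op).app M (c • e) = 0 := by
  let D := localCohomology.diagram (localCohomology.idealPowersDiagram I) i
  have : HasColimit D := localCohomology.hasColimitDiagram.{0, 0} _ i
  let iso : (colimit D).obj M ≅ colimit (D ⋙ (evaluation _ _).obj M) :=
    colimitObjIsoColimitCompEvaluation D M
  let F := D ⋙ (evaluation _ (ModuleCat.{0} R)).obj M
  have key : (∀ y : (localCohomology I i).obj M, c • y = 0) ↔
      ∀ y : (colimit F : ModuleCat.{0} R), c • y = 0 := by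
    constructor
    · intro H y
      have := (ModuleCat.hom_apply_smul iso.inv c y).trans (H (iso.inv y))
      have h2 := congrArg iso.hom this
      exact (Iso.inv_hom_id_apply iso _).symm.trans (h2.trans (map_zero iso.hom.hom))
    · intro H y
      have := (ModuleCat.hom_apply_smul iso.hom c y).trans (H (iso.hom y))
      have h2 := congrArg iso.inv this
      rw [map_zero, Iso.hom_inv_id_apply] at h2
      exact h2
  rw [key]
  constructor
  · intro H a e
    have h1 := (ModuleCat.hom_apply_smul (colimit.ι F (op (op a))) c e).trans
      (H (colimit.ι F (op (op a)) e))
    have h2 : colimit.ι F (op (op a)) (c • (e : F.obj (op (op a)))) =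
       colimit.ι F (op (op a)) 0 := by rw [map_zero]; exact h1
    obtain ⟨k, f, g, hk⟩ := Concrete.colimit_exists_of_rep_eq F _ _ h2
    refine ⟨k.unop.unop, leOfHom f.unop.unop, ?_⟩
    rw [map_zero] at hk
    exact hk
  · intro H y
    obtain ⟨j, x, rfl⟩ := Concrete.colimit_exists_rep F y
    obtain ⟨b, h, hb⟩ := H j.unop.unop x
    refine (ModuleCat.hom_apply_smul (colimit.ι F j) c x).symm.trans ?_
    have hb' : F.map (homOfLE h).op.op (c • x) = 0 := hb
    rw [← colimit.w F (homOfLE h).op.op, ModuleCat.comp_apply, hb', map_zero]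

section
open Limits Opposite
variable {R : Type} [CommRing R] {X X' : ModuleCat.{0} R}

/-- The complex in the opposite category of modules computing the left derived functor
defining `Ext`. -/
abbrev CategoryTheory.ProjectiveResolution.yonedaComplex
    (P : ProjectiveResolution X) (Y : ModuleCat.{0} R) :
    ChainComplex (ModuleCat.{0} R)ᵒᵖ ℕ :=
  (((linearYoneda R (ModuleCat.{0} R)).obj Y).rightOp.mapHomologicalComplex _).obj P.complex

/-- The cochains of degree `n` with values in `Y`, as an object of the category of modules. -/
abbrev CategoryTheory.ProjectiveResolution.cochainObj
    (P : ProjectiveResolution X) (Y : ModuleCat.{0} R) (n : ℕ) : ModuleCat.{0} R :=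
  ModuleCat.of R (P.complex.X n ⟶ Y)

/-- The inclusion of cocycles into cochains. -/
def CategoryTheory.ProjectiveResolution.cocycleι
    (P : ProjectiveResolution X) (Y : ModuleCat.{0} R) (n : ℕ) :
    ((P.yonedaComplex Y).opcycles n).unop ⟶ P.cochainObj Y n :=
  ((P.yonedaComplex Y).pOpcycles n).unop

/-- The left derived functor is computed by the homology of `yonedaComplex`. -/
def CategoryTheory.ProjectiveResolution.isoHomology
    (P : ProjectiveResolution X) (Y : ModuleCat.{0} R) (n : ℕ) :
    (((linearYoneda R (ModuleCat.{0} R)).obj Y).rightOp.leftDerived n).obj X ≅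
      (P.yonedaComplex Y).homology n :=
  P.isoLeftDerivedObj ((linearYoneda R (ModuleCat.{0} R)).obj Y).rightOp n

/-- The projection of cocycles onto `Ext`. -/
def CategoryTheory.ProjectiveResolution.cocycleπ
    (P : ProjectiveResolution X) (Y : ModuleCat.{0} R) (n : ℕ) :
    ((P.yonedaComplex Y).opcycles n).unop ⟶
      ((Ext R (ModuleCat.{0} R) n).obj (op X)).obj Y :=
  ((P.isoHomology Y n).hom ≫ (P.yonedaComplex Y).homologyι n).unop

/-- The cochain `f` is a cocycle representing the class `e`. -/
def CategoryTheory.ProjectiveResolution.Represents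
    (P : ProjectiveResolution X) (Y : ModuleCat.{0} R) (n : ℕ)
    (f : P.complex.X n ⟶ Y) (e : ((Ext R (ModuleCat.{0} R) n).obj (op X)).obj Y) : Prop :=
  ∃ z, P.cocycleι Y n z = f ∧ P.cocycleπ Y n z = e

namespace CategoryTheory.ProjectiveResolution

variable (P : ProjectiveResolution X) (Y : ModuleCat.{0} R) (n : ℕ)

lemma mono_cocycleι : Mono (P.cocycleι Y n) := by
  exact unop_mono_of_epi ((P.yonedaComplex Y).pOpcycles n)

lemma epi_cocycleπ : Epi (P.cocycleπ Y n) := by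
  exact unop_epi_of_mono ((P.isoHomology Y n).hom ≫ (P.yonedaComplex Y).homologyι n)

lemma exact_cocycleι :
    Function.Exact (P.cocycleι Y n)
      (fun f : P.complex.X n ⟶ Y => P.complex.d (n + 1) n ≫ f) := by
  have h := (ShortComplex.exact_of_g_is_cokernel
    (ShortComplex.mk _ _ ((P.yonedaComplex Y).d_pOpcycles (n + 1) n))
    ((P.yonedaComplex Y).opcyclesIsCokernel (n + 1) n (by simp))).unop
  have h2 := (ShortComplex.ShortExact.moduleCat_exact_iff_function_exact _).mp h
  exact h2

lemma exact_cocycleπ (z) :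
    P.cocycleπ Y n z = 0 ↔ ∃ g : P.complex.X ((ComplexShape.down ℕ).next n) ⟶ Y,
      P.complex.d n _ ≫ g = P.cocycleι Y n z := by
  have h := (ShortComplex.exact_of_f_is_kernel
    (ShortComplex.mk _ _ ((P.yonedaComplex Y).homologyι_comp_fromOpcycles n _))
    ((P.yonedaComplex Y).homologyIsKernel n _ rfl)).unop
  have h2 := (ShortComplex.ShortExact.moduleCat_exact_iff_function_exact _).mp h
  have h3 : P.cocycleπ Y n z = 0 ↔ ((P.yonedaComplex Y).homologyι n).unop z = 0 := by
    have inj := (ModuleCat.mono_iff_injective (P.isoHomology Y n).hom.unop).mp inferInstance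
    exact ⟨fun h => inj (Eq.trans h (map_zero (P.isoHomology Y n).hom.unop.hom).symm),
      fun h => (congrArg (P.isoHomology Y n).hom.unop h).trans
        (map_zero (P.isoHomology Y n).hom.unop.hom)⟩
  rw [h3]
  refine (h2 z).trans (exists_congr fun g => ?_)
  have hp := congrArg Quiver.Hom.unop
    ((P.yonedaComplex Y).p_fromOpcycles n ((ComplexShape.down ℕ).next n))
  have inj := (ModuleCat.mono_iff_injective _).mp (P.mono_cocycleι Y n)
  have := congrArg (fun φ => φ.hom g) hp
  exact inj.eq_iff.symm.trans ⟨fun h => (this.symm.trans h), fun h => this.trans h⟩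

variable {P Y n}

lemma exists_represents (e : ((Ext R (ModuleCat.{0} R) n).obj (op X)).obj Y) :
    ∃ f, P.Represents Y n f e := by
  obtain ⟨z, hz⟩ := (ModuleCat.epi_iff_surjective _).mp (P.epi_cocycleπ Y n) e
  exact ⟨_, z, rfl, hz⟩

lemma exists_represents_of_d_comp (f : P.complex.X n ⟶ Y) (hf : P.complex.d (n + 1) n ≫ f = 0) :
    ∃ e, P.Represents Y n f e := by
  obtain ⟨z, hz⟩ := (P.exact_cocycleι Y n f).mp hf
  exact ⟨_, z, hz, rfl⟩

lemma Represents.d_comp {f e} (h : P.Represents Y n f e) : P.complex.d (n + 1) n ≫ f = 0 := by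
  obtain ⟨z, rfl, -⟩ := h
  exact (P.exact_cocycleι Y n _).mpr ⟨z, rfl⟩

lemma Represents.eq_zero_iff {f e} (h : P.Represents Y n f e) :
    e = 0 ↔ ∃ g : P.complex.X ((ComplexShape.down ℕ).next n) ⟶ Y, P.complex.d n _ ≫ g = f := by
  obtain ⟨z, rfl, rfl⟩ := h
  exact P.exact_cocycleπ Y n z

lemma Represents.smul {f e} (h : P.Represents Y n f e) (c : R) :
    P.Represents Y n (c • f) (c • e) := by
  obtain ⟨z, rfl, rfl⟩ := h
  exact ⟨c • z, ModuleCat.hom_apply_smul _ c z, ModuleCat.hom_apply_smul _ c z⟩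

lemma Represents.map {f e} (h : P.Represents Y n f e) {P' : ProjectiveResolution X'}
    {g : X' ⟶ X} (φ : Hom P' P g) :
    P'.Represents Y n (φ.hom.f n ≫ f) (((Ext R (ModuleCat.{0} R) n).map g.op).app Y e) := by
  obtain ⟨z, rfl, rfl⟩ := h
  let F := ((linearYoneda R (ModuleCat.{0} R)).obj Y).rightOp
  let ψ : P'.yonedaComplex Y ⟶ P.yonedaComplex Y := (F.mapHomologicalComplex _).map φ.hom
  refine ⟨(HomologicalComplex.opcyclesMap ψ n).unop z, ?_, ?_⟩
  · have := congrArg Quiver.Hom.unop (HomologicalComplex.p_opcyclesMap ψ n)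
    exact congrArg (fun φ => φ.hom z) this
  · have h1 : (F.leftDerived n).map g ≫ (P.isoHomology Y n).hom =
        (P'.isoHomology Y n).hom ≫ HomologicalComplex.homologyMap ψ n :=
      ProjectiveResolution.isoLeftDerivedObj_hom_naturality g P' P φ.hom
        (by rw [φ.hom_f_zero_comp_π_f_zero]; rfl) F n
    have h2 := HomologicalComplex.homologyι_naturality ψ n
    have h3 : ((P'.isoHomology Y n).hom ≫ (P'.yonedaComplex Y).homologyι n) ≫
      HomologicalComplex.opcyclesMap ψ n = (F.leftDerived n).map g ≫
        (P.isoHomology Y n).hom ≫ (P.yonedaComplex Y).homologyι n := by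
      rw [Category.assoc, ← h2, reassoc_of% h1]
    exact congrArg (fun φ => φ.hom z) (congrArg Quiver.Hom.unop h3)

end CategoryTheory.ProjectiveResolution
end

section
open Limits Opposite
variable {R : Type} [CommRing R] {X X' : ModuleCat.{0} R}

namespace CategoryTheory.ProjectiveResolution

open CochainComplex HomComplex in
lemma extMk_eq_zero_iff' (P : ProjectiveResolution X) {Y : ModuleCat.{0} R} {n : ℕ}
    (f : P.complex.X n ⟶ Y) (hf : P.complex.d (n + 1) n ≫ f = 0) :
    P.extMk f (n + 1) rfl hf = 0 ↔
      ∃ g : P.complex.X ((ComplexShape.down ℕ).next n) ⟶ Y, P.complex.d n _ ≫ g = f := by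
  cases n with
  | succ n =>
    rw [P.extMk_eq_zero_iff f (n + 1 + 1) rfl hf n rfl]
    have : (ComplexShape.down ℕ).next (n + 1) = n := by simp
    rw [this]
  | zero =>
    have h0 : P.complex.d 0 ((ComplexShape.down ℕ).next 0) = 0 :=
      P.complex.shape _ _ (by simp)
    simp only [h0, zero_comp, exists_const]
    constructor
    · intro h
      rw [← P.extEquivCohomologyClass.apply_eq_iff_eq,
        extEquivCohomologyClass_extMk, extEquivCohomologyClass_zero,
        CohomologyClass.mk_eq_zero_iff, Cocycle.toSingleMk_mem_coboundaries_iff _ _ _ _ _ 1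
          (by simp)] at h
      obtain ⟨g, hg⟩ := h
      have hz : IsZero (P.cochainComplex.X 1) := by
        exact P.cochainComplex.isZero_of_isStrictlyLE 0 1 (by simp)
      rw [hz.eq_of_src g 0, comp_zero] at hg
      rw [← cancel_epi (P.cochainComplexXIso (-(0 : ℕ)) 0 rfl).hom, ← hg, comp_zero]
    · intro h
      subst h
      exact P.extMk_zero _ _

end CategoryTheory.ProjectiveResolution

/-- The element `c` annihilates the local cohomology of `M` in degree `i`, expressed by means
of Yoneda extensions. -/
def LCKills (I : Ideal R) (c : R) (i : ℕ) (M : ModuleCat.{0} R) : Prop :=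
  ∀ (a : ℕ) (e : Abelian.Ext (ModuleCat.of R (R ⧸ I ^ a)) M i),
    ∃ (b : ℕ) (h : a ≤ b), c • (Abelian.Ext.mk₀ (powProj I h)).comp e (zero_add i) = 0

lemma smul_extMk (P : ProjectiveResolution X) {Y : ModuleCat.{0} R} {n : ℕ}
    (f : P.complex.X n ⟶ Y) (hf : P.complex.d (n + 1) n ≫ f = 0) (c : R) :
    c • P.extMk f (n + 1) rfl hf = P.extMk (c • f) (n + 1) rfl (by simp [hf]) := by
  rw [Abelian.Ext.smul_eq_comp_mk₀, P.extMk_comp_mk₀]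
  congr 1

lemma smul_localCohomology_eq_zero_iff_lcKills (I : Ideal R) (c : R) (i : ℕ)
    (M : ModuleCat.{0} R) :
    (∀ y : (localCohomology I i).obj M, c • y = 0) ↔ LCKills I c i M := by
  rw [smul_localCohomology_eq_zero_iff]
  let P (a : ℕ) : ProjectiveResolution (ModuleCat.of R (R ⧸ I ^ a)) := projectiveResolution _
  refine forall_congr' fun a => ?_
  have key : ∀ (f : (P a).complex.X i ⟶ M)
      (e : ((Ext R (ModuleCat R) i).obj (op (ModuleCat.of R (R ⧸ I ^ a)))).obj M)
      (hfe : (P a).Represents M i f e) (b : ℕ) (h : a ≤ b),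
      ((Ext R (ModuleCat R) i).map (powProj I h).op).app M (c • e) = 0 ↔
      c • (Abelian.Ext.mk₀ (powProj I h)).comp
        ((P a).extMk f (i + 1) rfl hfe.d_comp) (zero_add i) = 0 := by
    intro f e hfe b h
    let φ : ProjectiveResolution.Hom (P b) (P a) (powProj I h) :=
      ⟨ProjectiveResolution.lift (powProj I h) (P b) (P a), by
        rw [ProjectiveResolution.lift_commutes_zero]; rfl⟩
    rw [((hfe.smul c).map φ).eq_zero_iff, ProjectiveResolution.mk₀_comp_extMk _ _ _ _ φ,
      smul_extMk, ProjectiveResolution.extMk_eq_zero_iff']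
    simp
  constructor
  · intro H e
    obtain ⟨f, hf, rfl⟩ := (P a).extMk_surjective e (i + 1) rfl
    obtain ⟨e', he'⟩ := ProjectiveResolution.exists_represents_of_d_comp f hf
    obtain ⟨b, h, hb⟩ := H e'
    exact ⟨b, h, (key f e' he' b h).mp hb⟩
  · intro H e
    obtain ⟨f, hf⟩ := ProjectiveResolution.exists_represents (P := P a) e
    obtain ⟨b, h, hb⟩ := H ((P a).extMk f (i + 1) rfl hf.d_comp)
    exact ⟨b, h, (key f e hf b h).mpr hb⟩
end

section
open Abelian
variable {R : Type} [CommRing R] (I : Ideal R)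

/-- The restriction of an extension of `R ⧸ I ^ a` along the projection from `R ⧸ I ^ b`. -/
def resExt {a b : ℕ} (h : a ≤ b) {M : ModuleCat.{0} R} {i : ℕ}
    (e : Abelian.Ext (ModuleCat.of R (R ⧸ I ^ a)) M i) :
    Abelian.Ext (ModuleCat.of R (R ⧸ I ^ b)) M i :=
  (Ext.mk₀ (powProj I h)).comp e (zero_add i)

variable {I}

lemma powProj_comp {a b c : ℕ} (h : a ≤ b) (h' : b ≤ c) :
    powProj I h' ≫ powProj I h = powProj I (h.trans h') := by
  apply ModuleCat.hom_ext
  apply LinearMap.ext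
  intro x
  obtain ⟨x, rfl⟩ := Ideal.Quotient.mk_surjective x
  rfl

section
variable {a b c : ℕ} (h : a ≤ b) (h' : b ≤ c) {M N : ModuleCat.{0} R} {i : ℕ}
    (e : Abelian.Ext (ModuleCat.of R (R ⧸ I ^ a)) M i)

lemma resExt_resExt : resExt I h' (resExt I h e) = resExt I (h.trans h') e := by
  simp only [resExt, Ext.mk₀_comp_mk₀_assoc, powProj_comp]

lemma resExt_smul (r : R) : resExt I h (r • e) = r • resExt I h e := by
  simp [resExt]

lemma resExt_comp {j k : ℕ} (x : Abelian.Ext M N j) (hk : i + j = k) :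
    resExt I h (e.comp x hk) = (resExt I h e).comp x hk := by
  simp only [resExt]
  rw [Ext.comp_assoc]
  lia
end

variable (I) in
/-- The annihilator of the `i`-th local cohomology module of `M`. -/
def lcAnn (i : ℕ) (M : Type) [AddCommGroup M] [Module R M] : Ideal R :=
  Module.annihilator R ((localCohomology I i).obj (ModuleCat.of R M))

variable {M : Type} [AddCommGroup M] [Module R M] {A : Type} [AddCommGroup A] [Module R A]
  {B : Type} [AddCommGroup B] [Module R B] {C : Type} [AddCommGroup C] [Module R C]
  {c d : R} {i : ℕ}

lemma mem_lcAnn_iff : c ∈ lcAnn I i M ↔ ∀ y : Paper.H R I i M, c • y = 0 :=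
  Module.mem_annihilator

lemma mem_lcAnn_iff_resExt :
    c ∈ lcAnn I i M ↔ ∀ (a : ℕ) (e : Abelian.Ext (ModuleCat.of R (R ⧸ I ^ a)) (ModuleCat.of R M) i),
      ∃ (b : ℕ) (h : a ≤ b), c • resExt I h e = 0 :=
  mem_lcAnn_iff.trans (smul_localCohomology_eq_zero_iff_lcKills I c i _)

lemma mem_lcAnn_of_smul_eq_zero (h : ∀ m : M, c • m = 0) : c ∈ lcAnn I i M := by
  rw [mem_lcAnn_iff_resExt]
  intro a e
  refine ⟨a, le_rfl, ?_⟩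
  have : c • 𝟙 (ModuleCat.of R M) = 0 := by
    ext m
    exact h m
  rw [Ext.smul_eq_comp_mk₀, this, Ext.mk₀_zero, Ext.comp_zero]

lemma mem_lcAnn_zero_iff :
    c ∈ lcAnn I 0 M ↔ ∀ (m : M) (n : ℕ), (∀ r ∈ I ^ n, r • m = 0) → c • m = 0 := by
  rw [mem_lcAnn_iff_resExt]
  constructor
  · intro H m n hm
    let f : ModuleCat.of R (R ⧸ I ^ n) ⟶ ModuleCat.of R M :=
      ModuleCat.ofHom (Submodule.liftQ (I ^ n) (LinearMap.toSpanSingleton R M m) hm)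
    obtain ⟨b, h, hb⟩ := H n (Ext.mk₀ f)
    rw [resExt, Ext.mk₀_comp_mk₀, ← Ext.mk₀_smul, Ext.mk₀_eq_zero_iff] at hb
    have h1 : c • f (powProj I h (Ideal.Quotient.mk _ 1)) = 0 :=
      congrArg (fun φ => φ.hom (Ideal.Quotient.mk _ 1)) hb
    have h2 : f (powProj I h (Ideal.Quotient.mk _ 1)) = (1 : R) • m := rfl
    rwa [h2, one_smul] at h1
  · intro H a e
    obtain ⟨f, rfl⟩ := Ext.mk₀_bijective _ _ |>.2 e
    refine ⟨a, le_rfl, ?_⟩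
    rw [resExt, Ext.mk₀_comp_mk₀, ← Ext.mk₀_smul, Ext.mk₀_eq_zero_iff]
    apply ModuleCat.hom_ext
    apply LinearMap.ext
    intro x
    refine H _ a ?_
    intro r hr
    rw [← ModuleCat.hom_apply_smul]
    have : r • (x : ModuleCat.of R (R ⧸ I ^ a)) = 0 := by
      obtain ⟨x, rfl⟩ := Ideal.Quotient.mk_surjective x
      exact Ideal.Quotient.eq_zero_iff_mem.mpr (Ideal.mul_mem_right _ _ hr)
    exact (congrArg _ this).trans (map_zero (powProj I le_rfl ≫ f).hom)

/-- The short exact sequence of `R`-modules attached to linear maps. -/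
lemma shortExact_of_linearMap {f : A →ₗ[R] B} {g : B →ₗ[R] C} (hf : Function.Injective f)
    (hfg : Function.Exact f g) (hg : Function.Surjective g) :
    (ModuleCat.shortComplexOfCompEqZero f g hfg.linearMap_comp_eq_zero).ShortExact :=
  ModuleCat.shortComplex_shortExact _ hfg hf hg

section
variable {f : A →ₗ[R] B} {g : B →ₗ[R] C}

lemma mul_mem_lcAnn_middle (hf : Function.Injective f)
    (hfg : Function.Exact f g) (hg : Function.Surjective g)
    (hc : c ∈ lcAnn I i A) (hd : d ∈ lcAnn I i C) : c * d ∈ lcAnn I i B := by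
  have hS := shortExact_of_linearMap hf hfg hg
  rw [mem_lcAnn_iff_resExt] at *
  intro a e
  obtain ⟨b, h, hb⟩ := hd a (e.comp (Ext.mk₀ (ModuleCat.ofHom g)) (add_zero _))
  rw [resExt_comp, ← Ext.smul_comp] at hb
  obtain ⟨x, hx⟩ := Ext.covariant_sequence_exact₂ _ hS _ hb
  obtain ⟨b', h', hb'⟩ := hc b x
  refine ⟨b', h.trans h', ?_⟩
  rw [mul_smul, ← resExt_resExt h h', ← resExt_smul h' (resExt I h e), ← hx, resExt_comp,
    ← Ext.smul_comp, hb', Ext.zero_comp]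

lemma mul_mem_lcAnn_right (hf : Function.Injective f)
    (hfg : Function.Exact f g) (hg : Function.Surjective g)
    (hc : c ∈ lcAnn I i B) (hd : d ∈ lcAnn I (i + 1) A) : c * d ∈ lcAnn I i C := by
  have hS := shortExact_of_linearMap hf hfg hg
  rw [mem_lcAnn_iff_resExt] at *
  intro a e
  obtain ⟨b, h, hb⟩ := hd a (e.comp hS.extClass rfl)
  rw [resExt_comp, ← Ext.smul_comp] at hb
  obtain ⟨x, hx⟩ := Ext.covariant_sequence_exact₃ _ hS _ _ hb
  obtain ⟨b', h', hb'⟩ := hc b x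
  refine ⟨b', h.trans h', ?_⟩
  rw [mul_smul, ← resExt_resExt h h', ← resExt_smul h' (resExt I h e), ← hx, resExt_comp,
    ← Ext.smul_comp, hb', Ext.zero_comp]

lemma mul_mem_lcAnn_left (hf : Function.Injective f)
    (hfg : Function.Exact f g) (hg : Function.Surjective g)
    (hc : c ∈ lcAnn I i C) (hd : d ∈ lcAnn I (i + 1) B) : c * d ∈ lcAnn I (i + 1) A := by
  have hS := shortExact_of_linearMap hf hfg hg
  rw [mem_lcAnn_iff_resExt] at *
  intro a e
  obtain ⟨b, h, hb⟩ := hd a (e.comp (Ext.mk₀ (ModuleCat.ofHom f)) (add_zero _))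
  rw [resExt_comp, ← Ext.smul_comp] at hb
  obtain ⟨x, hx⟩ := Ext.covariant_sequence_exact₁ _ hS _ hb rfl
  obtain ⟨b', h', hb'⟩ := hc b x
  refine ⟨b', h.trans h', ?_⟩
  rw [mul_smul, ← resExt_resExt h h', ← resExt_smul h' (resExt I h e), ← hx, resExt_comp,
    ← Ext.smul_comp, hb', Ext.zero_comp]

lemma mem_lcAnn_zero_of_injective (hf : Function.Injective f) (hc : c ∈ lcAnn I 0 B) :
    c ∈ lcAnn I 0 A := by
  rw [mem_lcAnn_zero_iff] at *
  intro m n hm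
  apply hf
  rw [map_smul, map_zero]
  exact hc _ n fun r hr => by rw [← map_smul, hm r hr, map_zero]
end

lemma lcAnn_le_of_linearEquiv (e : A ≃ₗ[R] B) : lcAnn I i A ≤ lcAnn I i B := by
  intro c hc
  rw [← mul_one c]
  refine mul_mem_lcAnn_middle (f := e.toLinearMap) (g := (0 : B →ₗ[R] PUnit)) e.injective ?_
    (fun _ => ⟨0, rfl⟩) hc (mem_lcAnn_of_smul_eq_zero fun _ => rfl)
  intro b
  simp
end

section
variable {R : Type} [CommRing R]

lemma coheight_eq_ringKrullDim_quotient (I : Ideal R) :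
    Paper.coheight R I = ringKrullDim (R ⧸ I) := by
  rw [ringKrullDim_quotient, Paper.coheight]
  refine Order.krullDim_eq_of_orderIso
    { toFun := fun p => ⟨⟨p.1, p.2.1⟩, p.2.2⟩
      invFun := fun p => ⟨p.1.asIdeal, p.1.isPrime, p.2⟩
      left_inv := fun _ => rfl
      right_inv := fun _ => rfl
      map_rel_iff' := Iff.rfl }

lemma ringDim_eq_ringKrullDim : Paper.ringDim R = ringKrullDim R :=
  Order.krullDim_eq_of_orderIso
    { toFun := fun p => ⟨p.1, p.2⟩
      invFun := fun p => ⟨p.asIdeal, p.isPrime⟩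
      left_inv := fun _ => rfl
      right_inv := fun _ => rfl
      map_rel_iff' := Iff.rfl }

lemma dimMod_self : Paper.dimMod R R = ringKrullDim R := by
  rw [Paper.dimMod, coheight_eq_ringKrullDim_quotient,
    ← Module.supportDim_eq_ringKrullDim_quotient_annihilator, Module.supportDim_self_eq_ringKrullDim]

lemma exists_natCast_eq_ringKrullDim (L : Type) [CommRing L] [IsNoetherianRing L]
    [IsLocalRing L] : ∃ d : ℕ, ringKrullDim L = d := by
  obtain ⟨h1, h2⟩ := finiteRingKrullDim_iff_ne_bot_and_top.1
    (inferInstance : FiniteRingKrullDim L)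
  obtain ⟨a, ha⟩ := WithBot.ne_bot_iff_exists.1 h1
  rw [← ha] at h2 ⊢
  obtain ⟨b, rfl⟩ := ENat.ne_top_iff_exists.1 (by simpa using h2 : a ≠ ⊤)
  exact ⟨b, rfl⟩

lemma exists_natCast_eq_ringKrullDim_quotient {R : Type} [CommRing R] [IsNoetherianRing R]
    [IsLocalRing R] {I : Ideal R} (hI : I ≠ ⊤) : ∃ d : ℕ, ringKrullDim (R ⧸ I) = d := by
  have := Ideal.Quotient.nontrivial_iff.2 hI
  have : IsLocalRing (R ⧸ I) := .of_surjective' _ Ideal.Quotient.mk_surjective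
  exact exists_natCast_eq_ringKrullDim (R ⧸ I)

/-- Prime filtrations propagate annihilators of local cohomology from the residue domain at a
minimal prime of the support. -/
lemma not_lcAnn_le_of_forall_prime_eq [IsNoetherianRing R] {I p : Ideal R} [p.IsPrime] {i : ℕ}
    (hp : ¬ lcAnn I i (R ⧸ p) ≤ p) (M : Type) [AddCommGroup M] [Module R M] [hM : Module.Finite R M]
    (h : ∀ q : Ideal R, q.IsPrime → Module.annihilator R M ≤ q → q ≤ p → q = p) :
    ¬ lcAnn I i M ≤ p := by
  revert h
  induction hM using IsNoetherianRing.induction_on_isQuotientEquivQuotientPrime R with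
  | subsingleton N =>
    intro _ h
    refine (‹p.IsPrime›).ne_top ((Ideal.eq_top_iff_one p).2 (h ?_))
    exact mem_lcAnn_of_smul_eq_zero fun m => Subsingleton.elim _ _
  | quotient N q e =>
    intro h
    by_cases hq : q.1 ≤ p
    · have := h q.1 q.2 (by rw [e.annihilator_eq, Ideal.annihilator_quotient]) hq
      intro h'
      refine hp ((?_ : lcAnn I i (R ⧸ p) ≤ lcAnn I i N).trans h')
      obtain ⟨q, hq'⟩ := q
      subst this
      exact lcAnn_le_of_linearEquiv e.symm
    · intro h'
      apply hq
      intro s hs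
      refine h' (mem_lcAnn_of_smul_eq_zero fun m => ?_)
      have : s ∈ Module.annihilator R N := by rwa [e.annihilator_eq, Ideal.annihilator_quotient]
      exact Module.mem_annihilator.1 this m
  | exact N₁ N₂ N₃ f g hf hg hfg h₁ h₃ =>
    intro h
    have a₁ := h₁ fun q hq hq1 hqp => h q hq
      ((LinearMap.annihilator_le_of_injective f hf).trans hq1) hqp
    have a₃ := h₃ fun q hq hq1 hqp => h q hq
      ((LinearMap.annihilator_le_of_surjective g hg).trans hq1) hqp
    rw [SetLike.not_le_iff_exists] at a₁ a₃ ⊢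
    obtain ⟨c, hc, hcp⟩ := a₁
    obtain ⟨d, hd, hdp⟩ := a₃
    exact ⟨c * d, mul_mem_lcAnn_middle hf hfg hg hc hd, (‹p.IsPrime›).mul_notMem hcp hdp⟩
end

section
open IsLocalRing Pointwise
variable {R : Type} [CommRing R] [IsNoetherianRing R]

lemma exists_mem_iff_smul_eq_zero {M : Type} [AddCommGroup M] [Module R M] {q : Ideal R}
    (hq : q ∈ associatedPrimes R M) : ∃ m : M, ∀ r, r ∈ q ↔ r • m = 0 := by
  obtain ⟨-, m, rfl⟩ := isAssociatedPrime_iff.1 hq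
  exact ⟨m, fun r => by rw [Submodule.mem_colon_singleton, Submodule.mem_bot]⟩

/-- Prime avoidance: an ideal contained in no associated prime contains a regular element. -/
lemma exists_mem_isSMulRegular (J : Ideal R) (M : Type) [AddCommGroup M] [Module R M]
    [Module.Finite R M] (h : ∀ q ∈ associatedPrimes R M, ¬ J ≤ q) : ∃ x ∈ J, IsSMulRegular M x := by
  by_contra! hx
  have hsub : (J : Set R) ⊆ ⋃ q ∈ associatedPrimes R M, (q : Set R) := by
    rw [biUnion_associatedPrimes_eq_compl_regular]
    exact fun x hxJ => hx x hxJ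
  obtain ⟨q, hq, hJq⟩ := (Ideal.subset_union_prime_finite (associatedPrimes.finite R M)
    (f := id) ⊥ ⊥ fun q hq _ _ => hq.isPrime).1 hsub
  exact h q hq hJq

lemma exists_torsionBySet_eq (I : Ideal R) (M : Type) [AddCommGroup M] [Module R M]
    [Module.Finite R M] : ∃ n, ∀ m ≥ n, Submodule.torsionBySet R M (I ^ m : Ideal R) =
      Submodule.torsionBySet R M (I ^ n : Ideal R) := by
  obtain ⟨n, hn⟩ := monotone_stabilizes_iff_noetherian.2 (inferInstance : IsNoetherian R M)
    ⟨fun m => Submodule.torsionBySet R M (I ^ m : Ideal R), fun a b hab =>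
      Submodule.torsionBySet_le_torsionBySet_of_subset (Ideal.pow_le_pow_right hab)⟩
  exact ⟨n, fun m hm => (hn m hm).symm⟩

variable [IsLocalRing R]

lemma exists_mem_isSMulRegular_quotient_torsion (M : Type) [AddCommGroup M] [Module R M]
    [Module.Finite R M] {n : ℕ}
    (hn : ∀ m ≥ n, Submodule.torsionBySet R M (maximalIdeal R ^ m : Ideal R) =
      Submodule.torsionBySet R M (maximalIdeal R ^ n : Ideal R)) :
    ∃ x ∈ maximalIdeal R, IsSMulRegular
      (M ⧸ Submodule.torsionBySet R M (maximalIdeal R ^ n : Ideal R)) x := by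
  apply exists_mem_isSMulRegular
  rintro q hq hmq
  obtain ⟨y, hy⟩ := exists_mem_iff_smul_eq_zero hq
  obtain ⟨m, rfl⟩ := Submodule.Quotient.mk_surjective _ y
  have key : ∀ r ∈ maximalIdeal R, r • m ∈
      Submodule.torsionBySet R M (maximalIdeal R ^ n : Ideal R) := fun r hr => by
    rw [← Submodule.Quotient.mk_eq_zero, Submodule.Quotient.mk_smul]
    exact (hy r).1 (hmq hr)
  have hm : m ∈ Submodule.torsionBySet R M (maximalIdeal R ^ n : Ideal R) := by
    rw [← hn (n + 1) n.le_succ, Submodule.mem_torsionBySet_iff]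
    rintro ⟨a, ha⟩
    change a • m = 0
    have ha' : a ∈ maximalIdeal R ^ n * maximalIdeal R := by rwa [← pow_succ]
    clear ha
    refine Submodule.mul_induction_on ha' (fun s hs r hr => ?_) fun x y hx hy => ?_
    · rw [mul_smul]
      exact (Submodule.mem_torsionBySet_iff _ _).1 (key r hr) ⟨s, hs⟩
    · rw [add_smul, hx, hy, add_zero]
  refine hq.isPrime.ne_top ((Ideal.eq_top_iff_one _).2 ((hy 1).2 ?_))
  rw [one_smul, Submodule.Quotient.mk_eq_zero]
  exact hm

/-- An element annihilating the local cohomology of `M` in degrees below `t` has a power, with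
exponent depending on `t` only, which annihilates the elements of `M` of dimension below `t`. -/
lemma exists_pow_smul_eq_zero (R : Type) [CommRing R] [IsNoetherianRing R] [IsLocalRing R] (t : ℕ) :
    ∃ k : ℕ, ∀ (M : Type) [AddCommGroup M] [Module R M]
    [Module.Finite R M] (c : R), (∀ i < t, c ∈ lcAnn (maximalIdeal R) i M) → ∀ J : Ideal R,
    ringKrullDim (R ⧸ J) < t → ∀ m : M, (∀ j ∈ J, j • m = 0) → c ^ k • m = 0 := by
  induction t with
  | zero =>
    refine ⟨0, fun M _ _ _ c _ J hJ m hm => ?_⟩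
    have : J = ⊤ := by
      by_contra hJ'
      have := Ideal.Quotient.nontrivial_iff.2 hJ'
      exact absurd hJ (not_lt.2 ringKrullDim_nonneg_of_nontrivial)
    exact hm _ (this ▸ Submodule.mem_top)
  | succ t ih =>
    obtain ⟨k, hk⟩ := ih
    refine ⟨4 * k + 1, fun M _ _ _ c hc J hJ m hm => ?_⟩
    obtain ⟨n, hn⟩ := exists_torsionBySet_eq (maximalIdeal R) M
    obtain ⟨x, hx, hxr⟩ := exists_mem_isSMulRegular_quotient_torsion M hn
    set M₀ := Submodule.torsionBySet R M (maximalIdeal R ^ n : Ideal R) with hM₀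
    have hcM₀ : ∀ y ∈ M₀, c • y = 0 := fun y hy =>
      mem_lcAnn_zero_iff.1 (hc 0 (Nat.succ_pos t)) y n fun r hr =>
        (Submodule.mem_torsionBySet_iff _ _).1 hy ⟨r, hr⟩
    have hc₁ : ∀ i < t + 1, c * c ∈ lcAnn (maximalIdeal R) i (M ⧸ M₀) := fun i hi =>
      mul_mem_lcAnn_right M₀.injective_subtype
        (LinearMap.exact_subtype_mkQ M₀) M₀.mkQ_surjective (hc i hi)
        (mem_lcAnn_of_smul_eq_zero fun y => Subtype.ext (hcM₀ y y.2))
    set N := Submodule.torsionBySet R (M ⧸ M₀) (J : Set R) with hN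
    have hmJ : M₀.mkQ m ∈ N := by
      rw [hN, Submodule.mem_torsionBySet_iff]
      rintro ⟨j, hj⟩
      change j • M₀.mkQ m = 0
      rw [← map_smul, hm j hj, map_zero]
    have hNdim : Module.supportDim R N < (t + 1 : ℕ) := by
      refine lt_of_le_of_lt ?_ hJ
      rw [Module.supportDim_eq_ringKrullDim_quotient_annihilator]
      refine ringKrullDim_le_of_surjective (Ideal.Quotient.factor (?_ : J ≤ _))
        (Ideal.Quotient.factor_surjective _)
      intro j hj
      rw [Module.mem_annihilator]
      rintro ⟨y, hy⟩
      exact Subtype.ext ((Submodule.mem_torsionBySet_iff _ _).1 hy ⟨j, hj⟩)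
    have hmem : ∀ a : ℕ,
        c ^ (4 * k) • M₀.mkQ m ∈ maximalIdeal R ^ a • (⊤ : Submodule R (M ⧸ M₀)) := by
      intro a
      have hz : x ^ (a + 1) ∈ maximalIdeal R ^ a :=
        Ideal.pow_le_pow_right a.le_succ (Ideal.pow_mem_pow hx _)
      have hz' : x ^ (a + 1) ∈ maximalIdeal R := Ideal.pow_mem_of_mem _ hx _ a.succ_pos
      have hzr : IsSMulRegular (M ⧸ M₀) (x ^ (a + 1)) := hxr.pow _
      generalize x ^ (a + 1) = z at hz hz' hzr
      have hzN : IsSMulRegular N z := fun u v huv => Subtype.ext (hzr (congrArg Subtype.val huv))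
      have hdim : ringKrullDim (R ⧸ Module.annihilator R (QuotSMulTop z N)) < t := by
        rw [← Module.supportDim_eq_ringKrullDim_quotient_annihilator]
        rw [← Module.supportDim_quotSMulTop_succ_eq_supportDim hzN hz', Nat.cast_succ] at hNdim
        exact lt_of_add_lt_add_right hNdim
      have hex : Function.Exact (LinearMap.lsmul R (M ⧸ M₀) z)
          (Submodule.mkQ (z • (⊤ : Submodule R (M ⧸ M₀)))) := by
        intro u
        rw [Submodule.mkQ_apply, Submodule.Quotient.mk_eq_zero,
          Submodule.mem_smul_pointwise_iff_exists]
        simp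
      have hc₂ : ∀ i < t, c ^ 4 ∈ lcAnn (maximalIdeal R) i (QuotSMulTop z (M ⧸ M₀)) := by
        intro i hi
        have := mul_mem_lcAnn_right (f := LinearMap.lsmul R (M ⧸ M₀) z) hzr hex (Submodule.mkQ_surjective _)
          (hc₁ i (by omega)) (hc₁ (i + 1) (by omega))
        convert this using 1
        ring
      have key := hk (QuotSMulTop z (M ⧸ M₀)) (c ^ 4) hc₂ _ hdim
        (Submodule.mkQ (z • (⊤ : Submodule R (M ⧸ M₀))) (M₀.mkQ m)) fun j hj => by
          have h0 := Module.mem_annihilator.1 hj (Submodule.Quotient.mk ⟨M₀.mkQ m, hmJ⟩)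
          rw [← Submodule.Quotient.mk_smul, Submodule.Quotient.mk_eq_zero,
            Submodule.mem_smul_pointwise_iff_exists] at h0
          obtain ⟨w, -, hw⟩ := h0
          rw [← map_smul, Submodule.mkQ_apply, Submodule.Quotient.mk_eq_zero,
            Submodule.mem_smul_pointwise_iff_exists]
          exact ⟨w, trivial, congrArg Subtype.val hw⟩
      rw [← pow_mul, ← map_smul, Submodule.mkQ_apply, Submodule.Quotient.mk_eq_zero,
        Submodule.mem_smul_pointwise_iff_exists] at key
      obtain ⟨w, -, hw⟩ := key
      rw [← hw]
      exact Submodule.smul_mem_smul hz trivial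
    have hzero : c ^ (4 * k) • M₀.mkQ m = 0 := by
      have := Ideal.iInf_pow_smul_eq_bot_of_isLocalRing (M := M ⧸ M₀) (maximalIdeal R)
        (Ideal.IsPrime.ne_top inferInstance)
      rw [← Submodule.mem_bot R, ← this, Submodule.mem_iInf]
      exact hmem
    rw [pow_succ', mul_smul]
    apply hcM₀
    rwa [← map_smul, Submodule.mkQ_apply, Submodule.Quotient.mk_eq_zero] at hzero
end

section
open IsLocalRing Pointwise
variable {R : Type} [CommRing R]

lemma exists_notMem_forall_smul_eq_zero {p : Ideal R} [hp : p.IsPrime] {M : Type} [AddCommGroup M]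
    [Module R M] [Module.Finite R M] (h : ∀ m : M, ∃ s ∉ p, s • m = 0) :
    ∃ s ∉ p, ∀ m : M, s • m = 0 := by
  have h1 : (⟨p, hp⟩ : PrimeSpectrum R) ∉ Module.support R M := by
    rw [Module.notMem_support_iff']
    exact h
  rw [Module.mem_support_iff_of_finite, SetLike.not_le_iff_exists] at h1
  obtain ⟨s, hs, hsp⟩ := h1
  exact ⟨s, hsp, Module.mem_annihilator.1 hs⟩

variable [IsNoetherianRing R]

lemma exists_notMem_forall_mul_mem {p I J : Ideal R} [p.IsPrime]
    (h : ∀ z ∈ J, ∃ s ∉ p, s * z ∈ I) : ∃ s ∉ p, ∀ z ∈ J, s * z ∈ I := by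
  obtain ⟨s, hs, h'⟩ := exists_notMem_forall_smul_eq_zero (p := p)
    (M := Submodule.map (Submodule.mkQ I) J) (by
      rintro ⟨_, z, hz, rfl⟩
      obtain ⟨s, hs, h'⟩ := h z hz
      refine ⟨s, hs, Subtype.ext ?_⟩
      change s • Submodule.mkQ I z = 0
      rw [← map_smul, Submodule.mkQ_apply, Submodule.Quotient.mk_eq_zero]
      exact h')
  refine ⟨s, hs, fun z hz => ?_⟩
  have := congrArg Subtype.val (h' ⟨_, z, hz, rfl⟩)
  change s • Submodule.mkQ I z = 0 at this
  rwa [← map_smul, Submodule.mkQ_apply, Submodule.Quotient.mk_eq_zero] at this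

lemma exists_mul_pow_mem_of_mem_minimalPrimes {P I : Ideal R} [P.IsPrime] (hP : P ∈ I.minimalPrimes) :
    ∃ s ∉ P, ∃ m : ℕ, ∀ z ∈ P ^ (m + 1), s * z ∈ I := by
  let L := Localization.AtPrime P
  have hrad := IsLocalization.AtPrime.radical_map_of_mem_minimalPrimes (A := L) P I hP
  rw [Localization.AtPrime.map_eq_maximalIdeal] at hrad
  obtain ⟨m, hm⟩ := Ideal.exists_pow_le_of_le_radical_of_fg (I := maximalIdeal L)
    hrad.ge (IsNoetherian.noetherian _)
  obtain ⟨s, hs, h⟩ := exists_notMem_forall_mul_mem (p := P) (I := I) (J := P ^ (m + 1)) (by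
    intro z hz
    have : algebraMap R L z ∈ I.map (algebraMap R L) := by
      apply hm
      rw [← Localization.AtPrime.map_eq_maximalIdeal, ← Ideal.map_pow]
      exact Ideal.mem_map_of_mem _ (Ideal.pow_le_pow_right m.le_succ hz)
    rwa [IsLocalization.algebraMap_mem_map_algebraMap_iff P.primeCompl] at this)
  exact ⟨s, hs, m, h⟩

/-- Ideals in a Noetherian local ring are closed in the adic topologies. -/
lemma mem_of_forall_mem_sup_pow {L : Type} [CommRing L] [IsNoetherianRing L] [IsLocalRing L]
    {I J : Ideal L} (hJ : J ≠ ⊤) {a : L} (h : ∀ n : ℕ, a ∈ I ⊔ J ^ n) : a ∈ I := by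
  have := Ideal.iInf_pow_smul_eq_bot_of_isLocalRing (M := L ⧸ I) J hJ
  rw [← Ideal.Quotient.eq_zero_iff_mem]
  change (Submodule.mkQ I) a = 0
  rw [← Submodule.mem_bot L, ← this, Submodule.mem_iInf]
  intro n
  obtain ⟨x, hx, y, hy, rfl⟩ := Submodule.mem_sup.1 (h n)
  rw [map_add, Submodule.mkQ_apply, (Submodule.Quotient.mk_eq_zero I).2 hx, zero_add,
    ← mul_one y, ← smul_eq_mul, map_smul]
  exact Submodule.smul_mem_smul hy trivial

lemma mem_of_forall_exists_mul_mem {p P : Ideal R} [p.IsPrime] [P.IsPrime] (hpP : p ≤ P) {y : R}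
    (hy : y ∈ P) {c : R} (h : ∀ n : ℕ, ∃ s ∉ P, c * s ∈ p ⊔ Ideal.span {y ^ n}) : c ∈ p := by
  let L := Localization.AtPrime P
  have : algebraMap R L c ∈ p.map (algebraMap R L) := by
    refine mem_of_forall_mem_sup_pow (J := Ideal.span {algebraMap R L y}) ?_ fun n => ?_
    · refine (lt_of_le_of_lt (b := maximalIdeal L) ?_ (Ideal.IsPrime.ne_top inferInstance).lt_top).ne
      rw [Ideal.span_singleton_le_iff_mem, ← Localization.AtPrime.map_eq_maximalIdeal]
      exact Ideal.mem_map_of_mem _ hy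
    · obtain ⟨s, hs, h⟩ := h n
      rw [Ideal.span_singleton_pow, ← map_pow, ← Set.image_singleton, ← Ideal.map_span,
        ← Ideal.map_sup, IsLocalization.algebraMap_mem_map_algebraMap_iff P.primeCompl]
      exact ⟨s, hs, by rwa [mul_comm]⟩
  rw [IsLocalization.algebraMap_mem_map_algebraMap_iff P.primeCompl] at this
  obtain ⟨s, hs, h⟩ := this
  exact (‹p.IsPrime›.mem_or_mem h).resolve_left fun h => hs (hpP h)

variable [IsLocalRing R]

lemma ringKrullDim_quotient_le_add_one {p P : Ideal R} [hp : p.IsPrime] [hP : P.IsPrime] (hpP : p < P)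
    (hcov : ∀ q : Ideal R, q.IsPrime → p < q → q ≤ P → q = P) {c : R} (hcp : c ∉ p)
    (hc : ∀ i : ℕ, (i : WithBot ℕ∞) < ringKrullDim (R ⧸ p) →
      c ∈ lcAnn (maximalIdeal R) i (R ⧸ p)) :
    ringKrullDim (R ⧸ p) ≤ ringKrullDim (R ⧸ P) + 1 := by
  by_contra! hlt
  obtain ⟨y, hyP, hyp⟩ := SetLike.exists_of_lt hpP
  obtain ⟨e, he⟩ := exists_natCast_eq_ringKrullDim_quotient hP.ne_top
  obtain ⟨k, hk⟩ := exists_pow_smul_eq_zero R (e + 1)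
  refine hcp (hp.mem_of_pow_mem (2 * k) (mem_of_forall_exists_mul_mem hpP.le hyP fun n => ?_))
  wlog hn : 0 < n generalizing n
  · refine ⟨1, fun h => hP.ne_top ((Ideal.eq_top_iff_one _).2 h), ?_⟩
    obtain rfl : n = 0 := by omega
    simp
  have hmin : P ∈ (p ⊔ Ideal.span {y ^ n}).minimalPrimes := by
    refine ⟨⟨hP, sup_le hpP.le ?_⟩, fun q ⟨hq, hq1⟩ hq2 => ?_⟩
    · rw [Ideal.span_singleton_le_iff_mem]
      exact Ideal.pow_mem_of_mem _ hyP _ hn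
    · refine (hcov q hq (lt_of_le_of_ne (le_sup_left.trans hq1) ?_) hq2).ge
      rintro rfl
      apply hyp
      apply hp.mem_of_pow_mem n
      exact hq1 (le_sup_right (a := p) (Ideal.mem_span_singleton_self _))
  obtain ⟨s, hs, m, hm⟩ := exists_mul_pow_mem_of_mem_minimalPrimes hmin
  refine ⟨s, hs, ?_⟩
  have hinj : Function.Injective (LinearMap.lsmul R (R ⧸ p) (y ^ n)) := by
    rw [injective_iff_map_eq_zero]
    intro a
    obtain ⟨a, rfl⟩ := Submodule.Quotient.mk_surjective _ a
    rw [LinearMap.lsmul_apply, ← Submodule.Quotient.mk_smul, Submodule.Quotient.mk_eq_zero,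
      Submodule.Quotient.mk_eq_zero]
    exact fun h => (hp.mem_or_mem h).resolve_left fun h => hyp (hp.mem_of_pow_mem n h)
  let g : (R ⧸ p) →ₗ[R] R ⧸ (p ⊔ Ideal.span {y ^ n}) := Submodule.factor le_sup_left
  have hex : Function.Exact (LinearMap.lsmul R (R ⧸ p) (y ^ n)) g := by
    intro a
    obtain ⟨a, rfl⟩ := Submodule.Quotient.mk_surjective _ a
    rw [show g (Submodule.Quotient.mk a) = Submodule.Quotient.mk a from rfl,
      Submodule.Quotient.mk_eq_zero, Submodule.mem_sup]
    constructor
    · rintro ⟨b, hb, z, hz, rfl⟩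
      obtain ⟨w, rfl⟩ := Ideal.mem_span_singleton'.1 hz
      refine ⟨Submodule.Quotient.mk w, ?_⟩
      rw [LinearMap.lsmul_apply, ← Submodule.Quotient.mk_smul, smul_eq_mul, mul_comm,
        Submodule.Quotient.mk_add, (Submodule.Quotient.mk_eq_zero p).2 hb, zero_add]
    · rintro ⟨w, hw⟩
      obtain ⟨w, rfl⟩ := Submodule.Quotient.mk_surjective _ w
      rw [LinearMap.lsmul_apply, ← Submodule.Quotient.mk_smul, smul_eq_mul] at hw
      exact ⟨a - y ^ n * w, (Submodule.Quotient.eq p).1 hw.symm, y ^ n * w,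
        Ideal.mem_span_singleton.2 (dvd_mul_right _ _), by ring⟩
  have hg : Function.Surjective g := Submodule.factor_surjective _
  have hlc : ∀ i < e + 1, c ^ 2 ∈ lcAnn (maximalIdeal R) i (R ⧸ (p ⊔ Ideal.span {y ^ n})) := by
    intro i hi
    rw [pow_two]
    have hlt' : ∀ j ≤ e + 1, (j : WithBot ℕ∞) < ringKrullDim (R ⧸ p) := fun j hj => by
      refine lt_of_le_of_lt ?_ hlt
      rw [he]
      exact_mod_cast hj
    exact mul_mem_lcAnn_right hinj hex hg (hc i (hlt' _ (by omega))) (hc _ (hlt' _ (by omega)))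
  have := hk _ _ hlc (P ^ (m + 1)) (by
    rw [ringKrullDim_quotient, PrimeSpectrum.zeroLocus_pow _ m.succ_ne_zero,
      ← ringKrullDim_quotient, he]
    exact_mod_cast e.lt_succ_self) (Submodule.Quotient.mk s) (fun j hj => by
      rw [← Submodule.Quotient.mk_smul, Submodule.Quotient.mk_eq_zero, smul_eq_mul, mul_comm]
      exact hm j hj)
  rwa [← Submodule.Quotient.mk_smul, Submodule.Quotient.mk_eq_zero, ← pow_mul] at this
end

section
open Abelian
variable {R : Type} [CommRing R] {I : Ideal R} {c d : R} {i : ℕ}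
variable {A M N C : Type} [AddCommGroup A] [Module R A] [AddCommGroup M] [Module R M]
  [AddCommGroup N] [Module R N] [AddCommGroup C] [Module R C]

/-- If multiplication by `x` on `M` has kernel `A` and cokernel `C` and vanishes on local
cohomology, then the local cohomology of `M` is controlled by that of `A` and `C`. -/
lemma mul_mem_lcAnn_of_factor {x : R} {f : A →ₗ[R] M} {π : M →ₗ[R] N} {ι : N →ₗ[R] M}
    {g : M →ₗ[R] C} (hf : Function.Injective f) (hfπ : Function.Exact f π)
    (hπ : Function.Surjective π) (hι : Function.Injective ι) (hιg : Function.Exact ι g)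
    (hg : Function.Surjective g) (hx : ι ∘ₗ π = LinearMap.lsmul R M x)
    (hxM : x ∈ lcAnn I (i + 1) M) (hc : c ∈ lcAnn I i C) (hd : d ∈ lcAnn I (i + 1) A) :
    c * d ∈ lcAnn I (i + 1) M := by
  have hS := shortExact_of_linearMap hf hfπ hπ
  have hT := shortExact_of_linearMap hι hιg hg
  rw [mem_lcAnn_iff_resExt] at *
  intro a e
  obtain ⟨b, h, hb⟩ := hxM a e
  have hxe : x • resExt I h e =
      ((resExt I h e).comp (Ext.mk₀ (ModuleCat.ofHom π)) (add_zero _)).comp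
        (Ext.mk₀ (ModuleCat.ofHom ι)) (add_zero _) := by
    rw [Ext.comp_assoc_of_third_deg_zero, Ext.mk₀_comp_mk₀, ← ModuleCat.ofHom_comp, hx]
    exact Ext.smul_eq_comp_mk₀ _ _
  rw [hxe] at hb
  obtain ⟨y, hy⟩ := Ext.covariant_sequence_exact₁ _ hT _ hb rfl
  obtain ⟨b', h', hb'⟩ := hc b y
  have hz : (c • resExt I h' (resExt I h e)).comp (Ext.mk₀ (ModuleCat.ofHom π)) (add_zero _) = 0 := by
    rw [Ext.smul_comp, ← resExt_comp, ← hy, resExt_comp, ← Ext.smul_comp, hb', Ext.zero_comp]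
  obtain ⟨w, hw⟩ := Ext.covariant_sequence_exact₂ _ hS _ hz
  obtain ⟨b'', h'', hb''⟩ := hd b' w
  refine ⟨b'', (h.trans h').trans h'', ?_⟩
  rw [mul_comm, mul_smul, ← resExt_resExt (h.trans h') h'', ← resExt_resExt h h', ← resExt_smul,
    ← hw, resExt_comp, ← Ext.smul_comp, hb'', Ext.zero_comp]
end

section
variable {R : Type} [CommRing R] {I : Ideal R} {c d s x : R} {i : ℕ}
variable {M C : Type} [AddCommGroup M] [Module R M] [AddCommGroup C] [Module R C] {g : M →ₗ[R] C}

lemma mul_mem_lcAnn_smul_quotient (hs : ∀ m : M, x • m = 0 → s • m = 0)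
    (hxg : Function.Exact (LinearMap.lsmul R M x) g) (hg : Function.Surjective g)
    (hc : c ∈ lcAnn I i M) (hd : d ∈ lcAnn I (i + 1) M) :
    c * (d * s) ∈ lcAnn I i C := by
  set K := LinearMap.ker (LinearMap.lsmul R M x)
  set N := LinearMap.range (LinearMap.lsmul R M x)
  have h1 : d * s ∈ lcAnn I (i + 1) N :=
    mul_mem_lcAnn_right (f := K.subtype) (g := (LinearMap.lsmul R M x).rangeRestrict)
      K.injective_subtype (fun m => by simp [K, Subtype.ext_iff])
      (LinearMap.surjective_rangeRestrict _) hd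
      (mem_lcAnn_of_smul_eq_zero fun m => Subtype.ext (hs m m.2))
  exact mul_mem_lcAnn_right (f := N.subtype) N.injective_subtype
    (fun m => (hxg m).trans (by simp [N])) hg hc h1

lemma mul_mem_lcAnn_of_smul_quotient (hs : ∀ m : M, x • m = 0 → s • m = 0)
    (hxg : Function.Exact (LinearMap.lsmul R M x) g) (hg : Function.Surjective g)
    (hxM : x ∈ lcAnn I (i + 1) M) (hc : c ∈ lcAnn I i C) : c * s ∈ lcAnn I (i + 1) M := by
  set K := LinearMap.ker (LinearMap.lsmul R M x)
  set N := LinearMap.range (LinearMap.lsmul R M x)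
  exact mul_mem_lcAnn_of_factor (f := K.subtype) (π := (LinearMap.lsmul R M x).rangeRestrict)
    (ι := N.subtype) K.injective_subtype (fun m => by simp [K, Subtype.ext_iff])
    (LinearMap.surjective_rangeRestrict _) N.injective_subtype
    (fun m => (hxg m).trans (by simp [N])) hg rfl hxM hc
    (mem_lcAnn_of_smul_eq_zero fun m => Subtype.ext (hs m m.2))

lemma mem_lcAnn_zero_of_smul (hs : ∀ m : M, x • m = 0 → s • m = 0) (hx : x ∈ lcAnn I 0 M) :
    s ∈ lcAnn I 0 M := by
  rw [mem_lcAnn_zero_iff] at *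
  exact fun m n hm => hs m (hx m n hm)
end

section
open RingTheory.Sequence Abelian Pointwise

/-- A regular sequence shorter than another one contained in the same ideal can be extended. -/
lemma exists_isWeaklyRegular_append {R : Type} [CommRing R] [IsNoetherianRing R] {I : Ideal R} :
    ∀ (l₂ : List R) (M : Type) [AddCommGroup M] [Module R M] [Module.Finite R M] (l₁ : List R),
    (∀ x ∈ l₁, x ∈ I) → (∀ x ∈ l₂, x ∈ I) → I • (⊤ : Submodule R M) < ⊤ → IsRegular M l₁ →
    IsWeaklyRegular M l₂ →
    l₂.length < l₁.length → ∃ y ∈ I, IsWeaklyRegular M (l₂ ++ [y]) := by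
  intro l₂
  induction l₂ with
  | nil =>
    intro M _ _ _ l₁ h₁ h₂ hI hl₁ hl₂ hlen
    match l₁, hlen with
    | a :: l, _ =>
      refine ⟨a, h₁ a List.mem_cons_self, ?_⟩
      rw [List.nil_append, isWeaklyRegular_singleton_iff]
      exact ((isRegular_cons_iff M a l).1 hl₁).1
  | cons a l ih =>
    intro M _ _ _ l₁ h₁ h₂ hI hl₁ hl₂ hlen
    obtain ⟨ha, hl⟩ := (isWeaklyRegular_cons_iff M a l).1 hl₂
    rw [List.forall_mem_cons] at h₂
    have hI' : I • (⊤ : Submodule R (QuotSMulTop a M)) < ⊤ := by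
      rw [lt_top_iff_ne_top]
      intro eq
      apply hI.ne
      simpa [Submodule.comap_smul_top_of_surjective I _ (Submodule.mkQ_surjective _),
        Submodule.smul_mono_left ((Ideal.span_singleton_le_iff_mem I).mpr h₂.1),
        ← Submodule.ideal_span_singleton_smul] using congrArg (Submodule.comap (Submodule.mkQ _)) eq
    have hext := ((ModuleCat.exists_isRegular_tfae I l₁.length (ModuleCat.of R M) hI).out 1 3 :
      (∀ i < l₁.length, Subsingleton (Ext (ModuleCat.of R (Shrink.{0} (R ⧸ I)))
        (ModuleCat.of R M) i)) ↔ ∃ rs : List R,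
        rs.length = l₁.length ∧ (∀ r ∈ rs, r ∈ I) ∧ IsRegular M rs).2 ⟨l₁, rfl, h₁, hl₁⟩
    obtain ⟨l', hlen', h', hl'⟩ := ((ModuleCat.exists_isRegular_tfae I (l₁.length - 1)
      (ModuleCat.of R (QuotSMulTop a M)) hI').out 1 3 : _ ↔ ∃ rs : List R,
        rs.length = l₁.length - 1 ∧ (∀ r ∈ rs, r ∈ I) ∧ IsRegular (QuotSMulTop a M) rs).1
      fun i hi => by
        have zero1 := AddCommGrpCat.isZero_of_iff_subsingleton.mpr (hext i (by omega))
        have zero2 := AddCommGrpCat.isZero_of_iff_subsingleton.mpr (hext (i + 1) (by omega))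
        have hS : (ModuleCat.smulShortComplex (ModuleCat.of R M) a).ShortExact :=
          IsSMulRegular.smulShortComplex_shortExact ha
        exact AddCommGrpCat.subsingleton_of_isZero <| ShortComplex.Exact.isZero_of_both_zeros
          ((Ext.covariant_sequence_exact₃' _ hS) i (i + 1) rfl)
          (zero1.eq_zero_of_src _) (zero2.eq_zero_of_tgt _)
    obtain ⟨y, hy, hreg⟩ := ih (QuotSMulTop a M) l' h' h₂.2 hI' hl' hl
      (by rw [hlen']; rw [List.length_cons] at hlen; omega)
    exact ⟨y, hy, by rw [List.cons_append, isWeaklyRegular_cons_iff]; exact ⟨ha, hreg⟩⟩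

open IsLocalRing in
lemma isCMLocalRing_iff {L : Type} [CommRing L] [IsNoetherianRing L] [IsLocalRing L] :
    Paper.IsCMLocalRing L ↔ ∃ l : List L, (∀ x ∈ l, x ∈ maximalIdeal L) ∧ IsRegular L l ∧
      (l.length : WithBot ℕ∞) = ringKrullDim L := by
  rw [Paper.IsCMLocalRing, ringDim_eq_ringKrullDim, Paper.depthOn,
    IsLocalRing.jacobson_eq_maximalIdeal _ bot_ne_top, and_iff_right ‹_›]
  have hle : ∀ l : List L, IsRegular L l → (l.length : WithBot ℕ∞) ≤ ringKrullDim L := by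
    intro l hl
    rw [← ringKrullDim_add_length_eq_ringKrullDim_of_isRegular l hl]
    have : Nontrivial (L ⧸ Ideal.ofList l) := by
      rw [Ideal.Quotient.nontrivial_iff]
      have := hl.top_ne_smul
      rw [smul_eq_mul, Ideal.mul_top] at this
      exact this.symm
    exact le_add_of_nonneg_left ringKrullDim_nonneg_of_nontrivial
  constructor
  · intro h
    by_contra! hcon
    obtain ⟨d, hd⟩ := exists_natCast_eq_ringKrullDim L
    rw [hd] at h hcon hle
    have hlt : ∀ l : List L, (∀ x ∈ l, x ∈ maximalIdeal L) → IsRegular L l → l.length < d :=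
      fun l h1 h2 => lt_of_le_of_ne (by exact_mod_cast hle l h2) (by exact_mod_cast hcon l h1 h2)
    have hpos : 0 < d := (Nat.zero_le _).trans_lt (hlt [] (by simp) (by simp [isRegular_iff]))
    have : (⨆ l ∈ {l : List L | (∀ x ∈ l, x ∈ maximalIdeal L) ∧ IsRegular L l}, (l.length : ℕ∞)) ≤
        (d - 1 : ℕ) := by
      refine iSup₂_le fun l hl => ?_
      have := hlt l hl.1 hl.2
      exact_mod_cast (by omega : l.length ≤ d - 1)
    have h' : (⨆ l ∈ {l : List L | (∀ x ∈ l, x ∈ maximalIdeal L) ∧ IsRegular L l},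
      (l.length : ℕ∞)) = d := by exact_mod_cast h
    rw [h'] at this
    have : d ≤ d - 1 := by exact_mod_cast this
    omega
  · rintro ⟨l, h1, h2, h3⟩
    refine le_antisymm ?_ ?_
    · rw [← h3]
      refine WithBot.coe_le_coe.2 (iSup₂_le fun l' hl' => ?_)
      have := hle l' hl'.2
      rw [← h3] at this
      exact_mod_cast this
    · rw [← h3]
      exact WithBot.coe_le_coe.2 (le_iSup₂_of_le l ⟨h1, h2⟩ le_rfl)
end

section
open RingTheory.Sequence IsLocalRing
variable {R : Type} [CommRing R]

/-- The list `l` is a weakly regular sequence on the localization of the ring at `p`. -/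
def IsWeaklyRegularAt (p : Ideal R) [p.IsPrime] (l : List R) : Prop :=
  IsWeaklyRegular (Localization.AtPrime p) (l.map (algebraMap R (Localization.AtPrime p)))

lemma isWeaklyRegularAt_nil (p : Ideal R) [p.IsPrime] : IsWeaklyRegularAt p [] := by
  simp [IsWeaklyRegularAt]

lemma isWeaklyRegularAt_append_singleton_iff {p : Ideal R} [p.IsPrime] {l : List R} {x : R} :
    IsWeaklyRegularAt p (l ++ [x]) ↔ IsWeaklyRegularAt p l ∧
      ∀ a, x * a ∈ Ideal.ofList l → ∃ s ∉ p, s * a ∈ Ideal.ofList l := by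
  rw [IsWeaklyRegularAt, List.map_append, isWeaklyRegular_append_iff, IsWeaklyRegularAt,
    List.map_singleton, isWeaklyRegular_singleton_iff]
  refine and_congr_right fun _ => ?_
  set L := Localization.AtPrime p
  have hmem : ∀ b : R, algebraMap R L b ∈ Ideal.map (algebraMap R L) (Ideal.ofList l) ↔
      ∃ s ∉ p, s * b ∈ Ideal.ofList l := fun b =>
    IsLocalization.algebraMap_mem_map_algebraMap_iff p.primeCompl L _ b
  rw [smul_eq_mul, Ideal.mul_top, ← Ideal.map_ofList, isSMulRegular_iff_right_eq_zero_of_smul]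
  constructor
  · intro h a ha
    rw [← hmem, ← Ideal.Quotient.eq_zero_iff_mem]
    refine h _ ?_
    rw [← Ideal.Quotient.mk_eq_mk, ← Submodule.Quotient.mk_smul, Ideal.Quotient.mk_eq_mk,
      Ideal.Quotient.eq_zero_iff_mem, smul_eq_mul, ← map_mul]
    exact Ideal.mem_map_of_mem _ ha
  · intro h y hy
    obtain ⟨y, rfl⟩ := Ideal.Quotient.mk_surjective y
    rw [← Ideal.Quotient.mk_eq_mk, ← Submodule.Quotient.mk_smul, Ideal.Quotient.mk_eq_mk,
      Ideal.Quotient.eq_zero_iff_mem, smul_eq_mul] at hy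
    obtain ⟨a, s, rfl⟩ := IsLocalization.exists_mk'_eq p.primeCompl y
    rw [← IsLocalization.mk'_one (M := p.primeCompl) L x, ← IsLocalization.mk'_mul, one_mul,
      IsLocalization.mk'_mem_iff, hmem] at hy
    rw [Ideal.Quotient.eq_zero_iff_mem, IsLocalization.mk'_mem_iff, hmem]
    obtain ⟨t, ht, hta⟩ := hy
    obtain ⟨s, hs, hsa⟩ := h (t * a) (by rwa [mul_left_comm])
    exact ⟨s * t, p.primeCompl.mul_mem hs ht, by rwa [mul_assoc]⟩

lemma IsWeaklyRegularAt.of_le {p q : Ideal R} [p.IsPrime] [q.IsPrime] (hqp : q ≤ p) {l : List R}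
    (h : IsWeaklyRegularAt p l) : IsWeaklyRegularAt q l := by
  induction l using List.reverseRecOn with
  | nil => exact isWeaklyRegularAt_nil q
  | append_singleton l x ih =>
    rw [isWeaklyRegularAt_append_singleton_iff] at h ⊢
    exact ⟨ih h.1, fun a ha => (h.2 a ha).imp fun s hs => ⟨fun h' => hs.1 (hqp h'), hs.2⟩⟩

lemma IsWeaklyRegularAt.isRegular {p : Ideal R} [p.IsPrime] {l : List R}
    (h : IsWeaklyRegularAt p l) (hl : ∀ x ∈ l, x ∈ p) :
    IsRegular (Localization.AtPrime p) (l.map (algebraMap R (Localization.AtPrime p))) := by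
  refine (isRegular_iff_isWeaklyRegular_of_subset_maximalIdeal ?_).2 h
  rintro _ hx
  obtain ⟨z, hz, rfl⟩ := List.mem_map.1 hx
  exact (IsLocalization.AtPrime.to_map_mem_maximal_iff _ p z).2 (hl z hz)

lemma height_add_ringKrullDim_quotient_le (p : Ideal R) [hp : p.IsPrime] :
    p.height + ringKrullDim (R ⧸ p) ≤ ringKrullDim R := by
  have : Nonempty (PrimeSpectrum R) := ⟨⟨p, hp⟩⟩
  have h1 : ringKrullDim (R ⧸ p) = Order.coheight (⟨p, hp⟩ : PrimeSpectrum R) := by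
    rw [Order.coheight_eq_krullDim_Ici]
    exact ringKrullDim_quotient p
  have h2 : p.height = Order.height (⟨p, hp⟩ : PrimeSpectrum R) :=
    PrimeSpectrum.height_eq_orderHeight ⟨p, hp⟩
  rw [h1, h2, ringKrullDim, Order.krullDim_eq_iSup_height_add_coheight_of_nonempty]
  exact_mod_cast le_iSup (fun a : PrimeSpectrum R => Order.height a + Order.coheight a) ⟨p, hp⟩

variable [IsNoetherianRing R]

lemma IsWeaklyRegularAt.length_le_height {p : Ideal R} [p.IsPrime] {l : List R}
    (h : IsWeaklyRegularAt p l) (hl : ∀ x ∈ l, x ∈ p) : (l.length : ℕ∞) ≤ p.height := by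
  have h' := h.isRegular hl
  have h1 := ringKrullDim_add_length_eq_ringKrullDim_of_isRegular _ h'
  have : Nontrivial (Localization.AtPrime p ⧸
      Ideal.ofList (l.map (algebraMap R (Localization.AtPrime p)))) := by
    rw [Ideal.Quotient.nontrivial_iff]
    have := h'.top_ne_smul
    rw [smul_eq_mul, Ideal.mul_top] at this
    exact this.symm
  rw [IsLocalization.AtPrime.ringKrullDim_eq_height p (Localization.AtPrime p),
    List.length_map] at h1
  have h2 : (l.length : WithBot ℕ∞) ≤ p.height := by
    rw [← h1]
    exact le_add_of_nonneg_left ringKrullDim_nonneg_of_nontrivial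
  exact_mod_cast h2

lemma IsWeaklyRegularAt.eq_of_le {p q : Ideal R} [p.IsPrime] [q.IsPrime] {l : List R}
    (h : IsWeaklyRegularAt p l) (hl : p.height ≤ l.length) (hq : Ideal.ofList l ≤ q)
    (hqp : q ≤ p) : q = p := by
  have := (h.of_le hqp).length_le_height fun x hx => hq (Ideal.subset_span hx)
  exact Ideal.eq_of_le_of_height_le q hqp (hl.trans this)

lemma IsWeaklyRegularAt.height_le_length {q : Ideal R} [q.IsPrime] {l : List R}
    (h : IsWeaklyRegularAt q l) (hl : ∀ x ∈ l, x ∈ q)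
    (hCM : Paper.IsCMLocalRing (Localization.AtPrime q))
    (hq : q ∈ associatedPrimes R (R ⧸ Ideal.ofList l)) : q.height ≤ l.length := by
  set L := Localization.AtPrime q
  obtain ⟨l₁, h₁, hl₁, hlen⟩ := isCMLocalRing_iff.1 hCM
  rw [IsLocalization.AtPrime.ringKrullDim_eq_height q] at hlen
  have hlen' : (l₁.length : ℕ∞) = q.height := by exact_mod_cast hlen
  rw [← hlen']
  by_contra! hlt
  have hlt' : l.length < l₁.length := by exact_mod_cast hlt
  obtain ⟨y, hy, hreg⟩ := exists_isWeaklyRegular_append (I := maximalIdeal L)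
    (l.map (algebraMap R L)) L l₁ h₁ (fun x hx => by
      obtain ⟨z, hz, rfl⟩ := List.mem_map.1 hx
      exact (IsLocalization.AtPrime.to_map_mem_maximal_iff _ q z).2 (hl z hz))
    (by rw [smul_eq_mul, Ideal.mul_top]; exact (maximalIdeal.isMaximal L).ne_top.lt_top)
    hl₁ h (by rwa [List.length_map])
  rw [isWeaklyRegular_append_iff, isWeaklyRegular_singleton_iff, smul_eq_mul, Ideal.mul_top,
    isSMulRegular_iff_right_eq_zero_of_smul, ← Ideal.map_ofList] at hreg
  obtain ⟨m, hm⟩ := exists_mem_iff_smul_eq_zero hq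
  obtain ⟨a, rfl⟩ := Ideal.Quotient.mk_surjective m
  have hm' : ∀ r, r ∈ q ↔ r * a ∈ Ideal.ofList l := fun r => by
    rw [hm, ← Ideal.Quotient.mk_eq_mk, ← Submodule.Quotient.mk_smul, Ideal.Quotient.mk_eq_mk,
      Ideal.Quotient.eq_zero_iff_mem, smul_eq_mul]
  have hya : y * algebraMap R L a ∈ Ideal.map (algebraMap R L) (Ideal.ofList l) := by
    have hle : q * Ideal.span {a} ≤ Ideal.ofList l := by
      rw [Ideal.mul_le]
      rintro r hr b hb
      obtain ⟨b, rfl⟩ := Ideal.mem_span_singleton'.1 hb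
      rw [mul_left_comm]
      exact Ideal.mul_mem_left _ _ ((hm' r).1 hr)
    refine Ideal.map_mono hle ?_
    rw [Ideal.map_mul]
    refine Ideal.mul_mem_mul ?_ (Ideal.mem_map_of_mem _ (Ideal.mem_span_singleton_self a))
    rwa [Localization.AtPrime.map_eq_maximalIdeal]
  have := hreg.2 (Ideal.Quotient.mk _ (algebraMap R L a)) (by
    rw [← Ideal.Quotient.mk_eq_mk, ← Submodule.Quotient.mk_smul, Ideal.Quotient.mk_eq_mk,
      Ideal.Quotient.eq_zero_iff_mem, smul_eq_mul]
    exact hya)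
  rw [Ideal.Quotient.eq_zero_iff_mem,
    IsLocalization.algebraMap_mem_map_algebraMap_iff q.primeCompl] at this
  obtain ⟨s, hs, hsa⟩ := this
  exact hs ((hm' s).2 hsa)

lemma isCMLocalRing_of_isWeaklyRegularAt {p : Ideal R} [p.IsPrime] {l : List R}
    (h : IsWeaklyRegularAt p l) (hl : ∀ x ∈ l, x ∈ p) (hlen : (l.length : ℕ∞) = p.height) :
    Paper.IsCMLocalRing (Localization.AtPrime p) := by
  refine isCMLocalRing_iff.2 ⟨_, fun y hy => ?_, h.isRegular hl, ?_⟩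
  · obtain ⟨x, hx, rfl⟩ := List.mem_map.1 hy
    exact (IsLocalization.AtPrime.to_map_mem_maximal_iff _ p x).2 (hl x hx)
  · rw [IsLocalization.AtPrime.ringKrullDim_eq_height p, List.length_map, ← hlen]
    rfl
end

section
open IsLocalRing
variable {R : Type} [CommRing R]

lemma exists_exact_lsmul_ofList_append (l : List R) (x : R) :
    ∃ g : (R ⧸ Ideal.ofList l) →ₗ[R] (R ⧸ Ideal.ofList (l ++ [x])), Function.Surjective g ∧
      Function.Exact (LinearMap.lsmul R (R ⧸ Ideal.ofList l) x) g := by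
  have hle : Ideal.ofList l ≤ Ideal.ofList (l ++ [x]) := by
    rw [Ideal.ofList_append]
    exact le_sup_left
  refine ⟨Submodule.factor hle, Submodule.factor_surjective hle, fun m => ?_⟩
  obtain ⟨a, rfl⟩ := Submodule.mkQ_surjective _ m
  change Submodule.Quotient.mk a = 0 ↔ _
  rw [Submodule.Quotient.mk_eq_zero, Ideal.ofList_append, Ideal.ofList_singleton, Submodule.mem_sup]
  constructor
  · rintro ⟨b, hb, c, hc, rfl⟩
    obtain ⟨c, rfl⟩ := Ideal.mem_span_singleton'.1 hc
    refine ⟨Submodule.Quotient.mk c, ?_⟩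
    rw [LinearMap.lsmul_apply, ← Submodule.Quotient.mk_smul, Submodule.mkQ_apply,
      Submodule.Quotient.eq, smul_eq_mul, mul_comm x, sub_add_cancel_right]
    exact neg_mem hb
  · rintro ⟨y, hy⟩
    obtain ⟨c, rfl⟩ := Submodule.mkQ_surjective _ y
    rw [Submodule.mkQ_apply, LinearMap.lsmul_apply, ← Submodule.Quotient.mk_smul,
      Submodule.mkQ_apply, Submodule.Quotient.eq, smul_eq_mul] at hy
    exact ⟨_, neg_mem hy, c * x, Ideal.mem_span_singleton'.2 ⟨c, rfl⟩, by ring⟩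

lemma exists_notMem_forall_lt_mem {p : Ideal R} [hp : p.IsPrime] {t : ℕ} {J : ℕ → Ideal R}
    (h : ∀ i < t, ¬ J i ≤ p) : ∃ x ∉ p, ∀ i < t, x ∈ J i := by
  have : ¬ (Finset.range t).inf J ≤ p := by
    rw [hp.inf_le']
    rintro ⟨i, hi, hip⟩
    exact h i (Finset.mem_range.1 hi) hip
  obtain ⟨x, hx, hxp⟩ := SetLike.not_le_iff_exists.1 this
  exact ⟨x, hxp, fun i hi =>
    (Finset.inf_le (f := J) (Finset.mem_range.2 hi)) hx⟩

section
variable [IsNoetherianRing R]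

lemma mem_associatedPrimes_of_forall_eq {M : Type} [AddCommGroup M] [Module R M]
    [Module.Finite R M] {p : Ideal R} [hp : p.IsPrime] (hMp : Module.annihilator R M ≤ p)
    (h : ∀ q : Ideal R, q.IsPrime → Module.annihilator R M ≤ q → q ≤ p → q = p) :
    p ∈ associatedPrimes R M :=
  Module.associatedPrimes.minimalPrimes_annihilator_subset_associatedPrimes R M
    ⟨⟨hp, hMp⟩, fun q hq hqp => (h q hq.1 hq.2 hqp).ge⟩

lemma not_lcAnn_quotient_le_of_forall_prime_eq {I : Ideal R} {M : Type} [AddCommGroup M]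
    [Module R M] [Module.Finite R M] {p : Ideal R} [hp : p.IsPrime]
    (hMp : Module.annihilator R M ≤ p)
    (h : ∀ q : Ideal R, q.IsPrime → Module.annihilator R M ≤ q → q ≤ p → q = p) {t : ℕ}
    (ht : ∀ i < t, ¬ lcAnn I i M ≤ p) : ∀ i < t, ¬ lcAnn I i (R ⧸ p) ≤ p := by
  obtain ⟨m, hm⟩ := exists_mem_iff_smul_eq_zero (mem_associatedPrimes_of_forall_eq hMp h)
  set f : (R ⧸ p) →ₗ[R] M := Submodule.liftQ p (LinearMap.toSpanSingleton R M m)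
    fun r hr => (hm r).1 hr
  have hf : Function.Injective f := by
    rw [← LinearMap.ker_eq_bot]
    exact Submodule.ker_liftQ_eq_bot _ _ _ fun r hr => (hm r).2 hr
  intro i hi
  obtain ⟨c, hc, hcp⟩ := SetLike.not_le_iff_exists.1 (ht i hi)
  induction i generalizing c with
  | zero => exact fun h' => hcp (h' (mem_lcAnn_zero_of_injective hf hc))
  | succ i ih =>
    obtain ⟨c', hc', hcp'⟩ := SetLike.not_le_iff_exists.1 (ht i (by omega))
    obtain ⟨d, hd, hdp⟩ := SetLike.not_le_iff_exists.1
      (not_lcAnn_le_of_forall_prime_eq (ih (by omega) c' hc' hcp') (M ⧸ LinearMap.range f)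
        fun q hq hMq => h q hq ((LinearMap.annihilator_le_of_surjective _
          (Submodule.mkQ_surjective _)).trans hMq))
    intro h'
    exact (hp.mul_notMem hdp hcp) (h' (mul_mem_lcAnn_left hf (LinearMap.exact_map_mkQ_range f)
      (Submodule.mkQ_surjective _) hd hc))
end

variable [IsLocalRing R]

lemma exists_mem_maximalIdeal_notMem {p : Ideal R} [p.IsPrime] (hp : p ≠ maximalIdeal R) :
    ∃ c ∈ maximalIdeal R, c ∉ p :=
  SetLike.exists_of_lt ((le_maximalIdeal (Ideal.IsPrime.ne_top ‹_›)).lt_of_ne hp)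

variable [IsNoetherianRing R]

/-- Associated primes have large dimension when the local cohomology in low degrees is annihilated
by an element outside of them. -/
lemma le_ringKrullDim_quotient_of_mem_associatedPrimes {M : Type} [AddCommGroup M] [Module R M]
    [Module.Finite R M] {q : Ideal R} (hq : q ∈ associatedPrimes R M) {c : R} (hcq : c ∉ q) {t : ℕ}
    (hc : ∀ i < t, c ∈ lcAnn (maximalIdeal R) i M) : (t : WithBot ℕ∞) ≤ ringKrullDim (R ⧸ q) := by
  obtain ⟨m, hm⟩ := exists_mem_iff_smul_eq_zero hq
  obtain ⟨k, hk⟩ := exists_pow_smul_eq_zero R t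
  by_contra! hlt
  exact hcq (hq.isPrime.mem_of_pow_mem k ((hm _).2 (hk M c hc q hlt m fun j hj => (hm j).1 hj)))

lemma exists_isWeaklyRegularAt_append {p : Ideal R} [hp : p.IsPrime] (hpm : p ≠ maximalIdeal R)
    {l : List R} (hl : IsWeaklyRegularAt p l) {t n : ℕ} (hdim : ringKrullDim (R ⧸ p) < t)
    (hn : ∀ i < t, maximalIdeal R ^ n ≤ lcAnn (maximalIdeal R) i (R ⧸ Ideal.ofList l)) :
    ∃ x ∈ p, IsWeaklyRegularAt p (l ++ [x]) ∧ ∃ n', ∀ i, i + 1 < t →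
      maximalIdeal R ^ n' ≤ lcAnn (maximalIdeal R) i (R ⧸ Ideal.ofList (l ++ [x])) := by
  set M := R ⧸ Ideal.ofList l
  obtain ⟨a, ha⟩ := exists_torsionBySet_eq (maximalIdeal R) M
  set Γ := Submodule.torsionBySet R M (maximalIdeal R ^ a : Ideal R)
  have hΓ : ∀ {s}, s ∈ maximalIdeal R ^ a → ∀ m ∈ Γ, s • m = 0 := fun {s} hs m hm =>
    (Submodule.mem_torsionBySet_iff _ _).1 hm ⟨s, hs⟩
  obtain ⟨z, hz, hreg⟩ := exists_mem_isSMulRegular_quotient_torsion M ha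
  obtain ⟨x, hxp, hx⟩ : ∃ x ∈ p, IsSMulRegular (M ⧸ Γ) x := by
    refine exists_mem_isSMulRegular p _ fun q hq hpq => ?_
    have hqm : q ≠ maximalIdeal R := by
      rintro rfl
      obtain ⟨m, hm⟩ := exists_mem_iff_smul_eq_zero hq
      have hm0 : m = 0 := hreg (by simpa using (hm z).1 hz)
      exact hq.isPrime.ne_top ((Ideal.eq_top_iff_one _).2 ((hm 1).2 (by rw [hm0, smul_zero])))
    have := hq.isPrime
    obtain ⟨c, hc, hcq⟩ := exists_mem_maximalIdeal_notMem hqm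
    have hle := le_ringKrullDim_quotient_of_mem_associatedPrimes hq (c := c ^ n * c ^ a) (t := t)
      (fun h => hcq (this.mem_of_pow_mem (n + a) (by rwa [pow_add]))) fun i hi =>
        mul_mem_lcAnn_right Γ.injective_subtype (LinearMap.exact_subtype_mkQ Γ)
          Γ.mkQ_surjective (hn i hi (Ideal.pow_mem_pow hc n))
          (mem_lcAnn_of_smul_eq_zero fun m => Subtype.ext (hΓ (Ideal.pow_mem_pow hc a) m m.2))
    exact (hle.trans (ringKrullDim_le_of_surjective _ (Ideal.Quotient.factor_surjective hpq))).not_gt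
      hdim
  have hs : ∀ s ∈ maximalIdeal R ^ a, ∀ m : M, x • m = 0 → s • m = 0 := fun s hs m hm =>
    hΓ hs m ((Submodule.Quotient.mk_eq_zero Γ).1 (hx (by
      simp only [smul_zero]
      rw [← Submodule.Quotient.mk_smul, hm, Submodule.Quotient.mk_zero])))
  refine ⟨x, hxp, isWeaklyRegularAt_append_singleton_iff.2 ⟨hl, fun b hb => ?_⟩, n + (n + a),
    fun i hi => ?_⟩
  · obtain ⟨c, hc, hcp⟩ := exists_mem_maximalIdeal_notMem hpm
    refine ⟨c ^ a, fun h => hcp (hp.mem_of_pow_mem a h), ?_⟩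
    have := hs _ (Ideal.pow_mem_pow hc a) (Submodule.Quotient.mk b)
    rw [← Submodule.Quotient.mk_smul, ← Submodule.Quotient.mk_smul, Submodule.Quotient.mk_eq_zero,
      Submodule.Quotient.mk_eq_zero] at this
    exact this hb
  · obtain ⟨g, hg, hxg⟩ := exists_exact_lsmul_ofList_append l x
    rw [pow_add, pow_add, Ideal.mul_le]
    intro c hc y hy
    refine Submodule.mul_induction_on hy (fun d hd s hs' => ?_) fun y z hy hz => ?_
    · exact mul_mem_lcAnn_smul_quotient (hs s hs') hxg hg (hn i (by omega) hc) (hn (i + 1) hi hd)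
    · rw [mul_add]
      exact add_mem hy hz

/-- For a generalized Cohen-Macaulay ring, a nonmaximal prime contains a sequence of length its
height which is regular locally, with quotient a generalized Cohen-Macaulay module. -/
lemma exists_isWeaklyRegularAt_of_isGCM {p : Ideal R} [hp : p.IsPrime] (hpm : p ≠ maximalIdeal R)
    {d n e : ℕ} (hn : ∀ i < d, maximalIdeal R ^ n ≤ lcAnn (maximalIdeal R) i R)
    (hdim : ringKrullDim (R ⧸ p) = e) (k : ℕ) (hk : k + e ≤ d) :
    ∃ l : List R, l.length = k ∧ (∀ x ∈ l, x ∈ p) ∧ IsWeaklyRegularAt p l ∧ ∃ n', ∀ i, i + k < d →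
      maximalIdeal R ^ n' ≤ lcAnn (maximalIdeal R) i (R ⧸ Ideal.ofList l) := by
  induction k with
  | zero =>
    exact ⟨[], rfl, by simp, isWeaklyRegularAt_nil p, n, fun i hi => (hn i hi).trans
      (lcAnn_le_of_linearEquiv (Submodule.quotEquivOfEqBot _ Ideal.ofList_nil).symm)⟩
  | succ k ih =>
    obtain ⟨l, hlen, hlp, hl, n', hn'⟩ := ih (by omega)
    obtain ⟨x, hxp, hx, n'', h⟩ := exists_isWeaklyRegularAt_append hpm hl (t := d - k)
      (hdim.trans_lt (by exact_mod_cast (by omega : e < d - k)))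
      fun i hi => hn' i (by omega)
    refine ⟨l ++ [x], by simp [hlen], ?_, hx, n'', fun i hi => h i (by omega)⟩
    simpa [or_imp, forall_and] using ⟨hlp, hxp⟩
end

section
open IsLocalRing
variable {R : Type} [CommRing R] [IsNoetherianRing R]

/-- A version of prime avoidance producing elements which are regular locally at `p`. -/
lemma exists_mem_exists_notMem_smul_eq_zero {p J : Ideal R} [p.IsPrime] {M : Type}
    [AddCommGroup M] [Module R M] [Module.Finite R M]
    (h : ∀ q ∈ associatedPrimes R M, q ≤ p → ¬ J ≤ q) :
    ∃ x ∈ J, ∃ s ∉ p, ∀ m : M, x • m = 0 → s • m = 0 := by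
  obtain ⟨x, hxJ, hx⟩ : ∃ x ∈ J, ∀ q ∈ associatedPrimes R M, q ≤ p → x ∉ q := by
    by_contra! hcon
    have hsub : (J : Set R) ⊆ ⋃ q ∈ {q ∈ associatedPrimes R M | q ≤ p}, (q : Set R) := by
      intro x hxJ
      obtain ⟨q, hq, hqp, hxq⟩ := hcon x hxJ
      exact Set.mem_biUnion ⟨hq, hqp⟩ hxq
    obtain ⟨q, hq, hJq⟩ := (Ideal.subset_union_prime_finite
      ((associatedPrimes.finite R M).subset (Set.sep_subset _ _)) (f := id) ⊥ ⊥
      fun q hq _ _ => hq.1.isPrime).1 hsub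
    exact h q hq.1 hq.2 hJq
  set K := LinearMap.ker (LinearMap.lsmul R M x)
  have hK : ∀ m, m ∈ K ↔ x • m = 0 := fun m => Iff.rfl
  by_contra! hcon
  have hle : Module.annihilator R K ≤ p := by
    intro s hs
    by_contra hsp
    obtain ⟨m, hm, hsm⟩ := hcon x hxJ s hsp
    exact hsm (congrArg Subtype.val (Module.mem_annihilator.1 hs ⟨m, (hK m).2 hm⟩))
  obtain ⟨q, hq, hqp⟩ := Ideal.exists_minimalPrimes_le hle
  have hqK := Module.associatedPrimes.minimalPrimes_annihilator_subset_associatedPrimes R K hq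
  exact hx q (associatedPrimes.subset_of_injective K.injective_subtype hqK) hqp
    (hq.1.2 (Module.mem_annihilator.2 fun m => Subtype.ext m.2))

variable [IsLocalRing R]

/-- In an equidimensional local ring whose residue domains have uniform local cohomological
annihilators, dimension and height of a prime are complementary. -/
lemma ringKrullDim_le_height_add_ringKrullDim_quotient
    (hmin : ∀ p ∈ minimalPrimes R, ringKrullDim (R ⧸ p) = ringKrullDim R)
    (hann : ∀ (p : Ideal R) [p.IsPrime], p ≠ maximalIdeal R → ∃ c ∉ p, ∀ i : ℕ,
      (i : WithBot ℕ∞) < ringKrullDim (R ⧸ p) → c ∈ lcAnn (maximalIdeal R) i (R ⧸ p))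
    (p : Ideal R) [hp : p.IsPrime] {n : ℕ} (hn : p.height = n) :
    ringKrullDim R ≤ n + ringKrullDim (R ⧸ p) := by
  induction n generalizing p with
  | zero =>
    rw [hmin p (Ideal.height_eq_zero_iff.1 hn), Nat.cast_zero, zero_add]
  | succ n ih =>
    have hnle : ¬ p.height ≤ n := by
      rw [hn]
      exact_mod_cast n.lt_succ_self.not_ge
    rw [Ideal.height_le_iff_covBy] at hnle
    push Not at hnle
    obtain ⟨q, hq, hqp, hcov, hnq⟩ := hnle
    have h1 := Ideal.height_add_one_le_of_lt_of_isPrime hqp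
    have hqn : q.height = n := by
      refine le_antisymm ?_ hnq
      rw [hn, Nat.cast_add, Nat.cast_one] at h1
      exact (ENat.add_le_add_iff_right (by simp)).1 h1
    obtain ⟨c, hcq, hc⟩ := hann q (hqp.trans_le (le_maximalIdeal hp.ne_top)).ne
    have h2 := ringKrullDim_quotient_le_add_one hqp (fun q' hq' hqq' hq'p =>
      hq'p.eq_of_not_lt (hcov q' hq' hqq')) hcq hc
    calc ringKrullDim R ≤ n + ringKrullDim (R ⧸ q) := ih q hqn
      _ ≤ n + (ringKrullDim (R ⧸ p) + 1) := by gcongr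
      _ = _ := by rw [Nat.cast_add, Nat.cast_one, add_right_comm, add_assoc]

lemma not_lcAnn_quotient_ofList_le
    (hCM : ∀ (q : Ideal R) [q.IsPrime], q ≠ maximalIdeal R →
      Paper.IsCMLocalRing (Localization.AtPrime q)) {d : ℕ}
    (hann : ∀ (q : Ideal R) [q.IsPrime], q ≠ maximalIdeal R → ∀ i k : ℕ, q.height ≤ k →
      i + k < d → ¬ lcAnn (maximalIdeal R) i (R ⧸ q) ≤ q)
    {p : Ideal R} [hp : p.IsPrime] (hpm : p ≠ maximalIdeal R) (j : ℕ) (l : List R)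
    (hlp : ∀ x ∈ l, x ∈ p) (hl : IsWeaklyRegularAt p l) (hj : p.height ≤ (l.length + j : ℕ)) (i : ℕ)
    (hi : i + l.length < d) : ¬ lcAnn (maximalIdeal R) i (R ⧸ Ideal.ofList l) ≤ p := by
  have key : ∀ (l : List R), IsWeaklyRegularAt p l → ∀ (q : Ideal R) [q.IsPrime], q ≤ p →
      q.height ≤ l.length → ∀ i, i + l.length < d →
      ¬ lcAnn (maximalIdeal R) i (R ⧸ Ideal.ofList l) ≤ q := by
    intro l hl q _ hqp hql i hi
    refine not_lcAnn_le_of_forall_prime_eq (hann q ?_ i _ hql hi) _ fun q' hq' h1 h2 => ?_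
    · rintro rfl
      exact hpm (((maximalIdeal.isMaximal R).eq_of_le hp.ne_top hqp).symm)
    · rw [Ideal.annihilator_quotient] at h1
      exact (hl.of_le hqp).eq_of_le hql h1 h2
  induction j generalizing l i with
  | zero => exact key l hl p le_rfl hj i hi
  | succ j ih =>
    intro hle
    set J := (Finset.range (d - l.length)).inf
      fun i => lcAnn (maximalIdeal R) i (R ⧸ Ideal.ofList l)
    have hJ : ∀ i, i + l.length < d → J ≤ lcAnn (maximalIdeal R) i (R ⧸ Ideal.ofList l) :=
      fun i hi => Finset.inf_le (Finset.mem_range.2 (by omega))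
    obtain ⟨x, hxJ, s, hsp, hs⟩ := exists_mem_exists_notMem_smul_eq_zero (p := p) (J := J)
      (M := R ⧸ Ideal.ofList l) (by
        intro q hq hqp hJq
        have := hq.isPrime
        obtain ⟨i', hi', hle'⟩ := (this.inf_le').1 hJq
        have hqm : q ≠ maximalIdeal R := by
          rintro rfl
          exact hpm (((maximalIdeal.isMaximal R).eq_of_le hp.ne_top hqp).symm)
        refine key l hl q hqp ((hl.of_le hqp).height_le_length (fun x hx => ?_) (hCM q hqm) hq) i'
          (by have := Finset.mem_range.1 hi'; omega) hle'
        have := hq.annihilator_le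
        rw [Submodule.annihilator_top, Ideal.annihilator_quotient] at this
        exact this (Ideal.subset_span hx))
    have hxp : x ∈ p := hle (hJ i hi hxJ)
    have hreg : IsWeaklyRegularAt p (l ++ [x]) := by
      refine isWeaklyRegularAt_append_singleton_iff.2 ⟨hl, fun a ha => ⟨s, hsp, ?_⟩⟩
      have := hs (Submodule.Quotient.mk a)
      rw [← Submodule.Quotient.mk_smul, ← Submodule.Quotient.mk_smul,
        Submodule.Quotient.mk_eq_zero, Submodule.Quotient.mk_eq_zero] at this
      exact this ha
    obtain ⟨g, hg, hxg⟩ := exists_exact_lsmul_ofList_append l x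
    cases i with
    | zero => exact hsp (hle (mem_lcAnn_zero_of_smul hs (hJ 0 hi hxJ)))
    | succ i =>
      obtain ⟨c, hc, hcp⟩ := SetLike.not_le_iff_exists.1 (ih (l ++ [x])
        (by simpa [or_imp, forall_and] using ⟨hlp, hxp⟩) hreg
        (by simpa [add_assoc, add_comm 1] using hj) i
        (by simp only [List.length_append, List.length_singleton]; omega))
      exact hp.mul_notMem hcp hsp
        (hle (mul_mem_lcAnn_of_smul_quotient hs hxg hg (hJ _ hi hxJ) hc))
end

open IsLocalRing in
lemma exists_pow_maximalIdeal_le {R : Type} [CommRing R] [IsNoetherianRing R] [IsLocalRing R]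
    {J : Ideal R} (h : ∀ p : Ideal R, p.IsPrime → p ≠ maximalIdeal R → ¬ J ≤ p) :
    ∃ n, maximalIdeal R ^ n ≤ J := by
  refine Ideal.exists_pow_le_of_le_radical_of_fg ?_ (IsNoetherian.noetherian _)
  rw [Ideal.radical_eq_sInf]
  refine le_sInf fun p hp => ?_
  by_contra hle
  exact h p hp.2 (fun hpm => hle hpm.ge) hp.1

/-- An equidimensional Noetherian local ring is generalized Cohen–Macaulay iff for every
nonmaximal prime `p`, the localization `R_p` is Cohen–Macaulay and `R/p` has a uniform
local cohomological annihilator. -/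
theorem gCM_iff (R : Type) [CommRing R] [IsNoetherianRing R] [IsLocalRing R]
    (hequi : Paper.IsEquidim R R) :
    Paper.IsGCM R R ↔
      ∀ (p : Ideal R) [p.IsPrime], p ≠ IsLocalRing.maximalIdeal R →
        (Paper.IsCMLocalRing (Localization.AtPrime p) ∧ Paper.HasULCAQuot R p) := by
  obtain ⟨d, hd⟩ := exists_natCast_eq_ringKrullDim R
  have hGCM : Paper.IsGCM R R ↔ ∃ n, ∀ i < d, IsLocalRing.maximalIdeal R ^ n ≤
      lcAnn (IsLocalRing.maximalIdeal R) i R := by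
    simp only [Paper.IsGCM, dimMod_self, hd, Nat.cast_lt, SetLike.le_def, mem_lcAnn_iff]
  have hULCA : ∀ p : Ideal R, Paper.HasULCAQuot R p ↔ ∃ c ∉ p, ∀ i : ℕ,
      (i : WithBot ℕ∞) < ringKrullDim (R ⧸ p) →
        c ∈ lcAnn (IsLocalRing.maximalIdeal R) i (R ⧸ p) := fun p => by
    simp only [Paper.HasULCAQuot, coheight_eq_ringKrullDim_quotient, mem_lcAnn_iff]
  simp only [hGCM, hULCA]
  constructor
  · rintro ⟨n, hn⟩ p hp hpm
    obtain ⟨e, he⟩ := exists_natCast_eq_ringKrullDim_quotient hp.ne_top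
    obtain ⟨h, hh⟩ := ENat.ne_top_iff_exists.1 (Ideal.height_ne_top_of_isPrime (I := p))
    have hhe := height_add_ringKrullDim_quotient_le p
    rw [← hh, he, hd] at hhe
    have hhe : h + e ≤ d := by exact_mod_cast hhe
    obtain ⟨l, hlen, hlp, hl, n', hn'⟩ := exists_isWeaklyRegularAt_of_isGCM hpm hn he h hhe
    refine ⟨isCMLocalRing_of_isWeaklyRegularAt hl hlp (by rw [hlen, hh]), ?_⟩
    obtain ⟨c, hcp, hc⟩ := exists_notMem_forall_lt_mem (t := e)
      (not_lcAnn_quotient_le_of_forall_prime_eq (M := R ⧸ Ideal.ofList l) (p := p)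
        (by rw [Ideal.annihilator_quotient]; exact Ideal.span_le.2 hlp)
        (fun q _ hq hqp => hl.eq_of_le (by rw [← hh, hlen])
          (by rwa [Ideal.annihilator_quotient] at hq) hqp)
        (fun i hi hle => by
          obtain ⟨c, hc, hcp⟩ := exists_mem_maximalIdeal_notMem hpm
          exact hcp (hp.mem_of_pow_mem n' (hle (hn' i (by omega) (Ideal.pow_mem_pow hc n'))))))
    exact ⟨c, hcp, fun i hi => hc i (by rw [he] at hi; exact_mod_cast hi)⟩
  · intro H
    have hmin : ∀ p ∈ minimalPrimes R, ringKrullDim (R ⧸ p) = ringKrullDim R := fun p hp => by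
      have := hequi p (by rwa [Paper.minSupp, Module.annihilator_eq_bot.2 inferInstance])
      rwa [coheight_eq_ringKrullDim_quotient, dimMod_self] at this
    have hann : ∀ (q : Ideal R) [q.IsPrime], q ≠ IsLocalRing.maximalIdeal R → ∀ i k : ℕ,
        q.height ≤ k → i + k < d → ¬ lcAnn (IsLocalRing.maximalIdeal R) i (R ⧸ q) ≤ q := by
      intro q hq hqm i k hk hik hle
      obtain ⟨h, hh⟩ := ENat.ne_top_iff_exists.1 (Ideal.height_ne_top_of_isPrime (I := q))
      have hdim := ringKrullDim_le_height_add_ringKrullDim_quotient hmin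
        (fun p _ hpm => (H p hpm).2) q hh.symm
      obtain ⟨e, he⟩ := exists_natCast_eq_ringKrullDim_quotient hq.ne_top
      obtain ⟨c, hcq, hc⟩ := (H q hqm).2
      rw [he] at hc hdim
      rw [hd] at hdim
      rw [← hh] at hk
      have hdim : d ≤ h + e := by exact_mod_cast hdim
      have hk : h ≤ k := by exact_mod_cast hk
      exact hcq (hle (hc i (by exact_mod_cast (by omega : i < e))))
    obtain ⟨n, hn⟩ := exists_pow_maximalIdeal_le
      (J := (Finset.range d).inf fun i => lcAnn (IsLocalRing.maximalIdeal R) i R) (by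
        intro p hp hpm hle
        obtain ⟨i, hi, hip⟩ := (hp.inf_le').1 hle
        obtain ⟨h, hh⟩ := ENat.ne_top_iff_exists.1 (Ideal.height_ne_top_of_isPrime (I := p))
        exact not_lcAnn_quotient_ofList_le (fun q _ hqm => (H q hqm).1) hann hpm h [] (by simp)
          (isWeaklyRegularAt_nil p) (by simp [← hh]) i (by simpa using hi)
          ((lcAnn_le_of_linearEquiv (Submodule.quotEquivOfEqBot _ Ideal.ofList_nil)).trans hip))
    exact ⟨n, fun i hi => hn.trans (Finset.inf_le (Finset.mem_range.2 hi))⟩
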